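/- arXiv:2603.16282 — 7 statements merged into one kernel-verified Lean document; each statement's English description precedes it below -/
import Mathlib

section
/- Let d ≥ 1 be an integer, μ > −1/2, α = μ + (d−1)/2, let m ≤ n and m′ ≤ n′ be natural numbers, and let p, q be real numbers with p > 2·max(n,n′) + 2μ + d and q > −2μ − d. Let P be a ball orthogonal polynomial of degree m and P′ a ball orthogonal polynomial of degree m′ for the weight w_μ. Set b^M := b_μ^B · c_{p−2α, q+2α}. Then b^M · ∫∫_{{(x,t)∈ℝ^d×ℝ : ‖x‖ ≤ t}} M_{n−m}^{(p−2α−2m, q+2α+2m)}(t) t^m P(x/t) · M_{n′−m′}^{(p−2α−2m′, q+2α+2m′)}(t) t^{m′} P′(x/t) · (t²−‖x‖²)^{μ−1/2} t^q (1+t)^{−(p+q)} dx dt equals (c_{p−2α, q+2α}/c_{p−2α−2m, q+2α+2m}) · h_{n−m}^{(p−2α−2m, q+2α+2m)} · ( b_μ^B ∫_{B^d} P(y)P′(y)(1−‖y‖²)^{μ−1/2} dy ) if n = n′ and m = m′, and equals 0 otherwise. -/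
open MeasureTheory Real

/-- First-class finite orthogonal polynomial `M_n^{(p,q)}` defined via the Rodrigues formula. -/
noncomputable def finiteM (p q : ℝ) (n : ℕ) (x : ℝ) : ℝ :=
  (-1 : ℝ) ^ n * (1 + x) ^ (p + q) * x ^ (-q) *
    iteratedDeriv n (fun y : ℝ => y ^ ((n : ℝ) + q) * (1 + y) ^ ((n : ℝ) - p - q)) x

/-- The normalization constant `c_{p,q} = Γ(p+q)/(Γ(p−1)Γ(q+1))`. -/
noncomputable def cM (p q : ℝ) : ℝ :=
  Real.Gamma (p + q) / (Real.Gamma (p - 1) * Real.Gamma (q + 1))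

/-- The norm square `h_n^{(p,q)} = n! Γ(p−n) Γ(p+q) (q+1)_n / (Γ(p−1)(p−2n−1)Γ(p+q−n))`. -/
noncomputable def hM (p q : ℝ) (n : ℕ) : ℝ :=
  (n.factorial : ℝ) * Real.Gamma (p - n) * Real.Gamma (p + q) *
      (ascPochhammer ℝ n).eval (q + 1) /
    (Real.Gamma (p - 1) * (p - 2 * n - 1) * Real.Gamma (p + q - n))

/-- Normalization constant of the ball weight `w_μ` on the unit ball of `ℝ^d`. -/
noncomputable def ballB (d : ℕ) (μ : ℝ) : ℝ :=
  Real.Gamma (μ + ((d : ℝ) + 1) / 2) / (Real.pi ^ ((d : ℝ) / 2) * Real.Gamma (μ + 1/2))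

/-- `P` is a ball orthogonal polynomial of degree `m` on the unit ball `B^d` for the weight
`w_μ(y) = (1 − ‖y‖²)^{μ−1/2}`: it is a polynomial of total degree `m` orthogonal to all
polynomials of lower total degree. -/
def IsBallOrtho (d : ℕ) (μ : ℝ) (m : ℕ) (P : EuclideanSpace ℝ (Fin d) → ℝ) : Prop :=
  ∃ Q : MvPolynomial (Fin d) ℝ,
    Q.totalDegree = m ∧ (∀ y : EuclideanSpace ℝ (Fin d), P y = MvPolynomial.eval (fun i => y i) Q) ∧
    ∀ R : MvPolynomial (Fin d) ℝ, R.totalDegree < m →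
      ∫ y in Metric.closedBall (0 : EuclideanSpace ℝ (Fin d)) 1,
        P y * MvPolynomial.eval (fun i => y i) R * (1 - ‖y‖ ^ 2) ^ (μ - 1/2) = 0

namespace BallM
open Set Filter Topology Polynomial

/-- Polynomial part of iterated derivatives. -/
noncomputable def qP (s r : ℝ) : ℕ → Polynomial ℝ
  | 0 => 1
  | i + 1 => (C (s - i) * (1 + X) + C (r - i) * X) * qP s r i + X * (1 + X) * derivative (qP s r i)

lemma qP_expand (s r : ℝ) (i : ℕ) : qP s r (i+1) = C (s-i) * qP s r i +
    C (s - i + (r - i)) * (X * qP s r i) + X * derivative (qP s r i) +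
    X * (X * derivative (qP s r i)) := by
  simp only [qP, map_add]
  ring

lemma coeff_X_mul_derivative (f : Polynomial ℝ) (i : ℕ) :
    (X * derivative f).coeff i = i * f.coeff i := by
  cases i with
  | zero => simp
  | succ i => rw [coeff_X_mul, coeff_derivative]; push_cast; ring

lemma qP_coeff_gt (s r : ℝ) (i : ℕ) : ∀ j, i < j → (qP s r i).coeff j = 0 := by
  induction i with
  | zero => intro j hj; simp [qP, coeff_one]; omega
  | succ i ih =>
    intro j hj
    obtain ⟨j, rfl⟩ : ∃ k, j = k + 1 := ⟨j - 1, by omega⟩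
    rw [qP_expand]
    simp only [coeff_add, coeff_C_mul]
    rw [coeff_X_mul_derivative, coeff_X_mul, coeff_X_mul, coeff_X_mul_derivative,
      ih _ (by omega), ih j (by omega)]
    simp

lemma qP_coeff_self (s r : ℝ) (i : ℕ) :
    (qP s r i).coeff i = ∏ j ∈ Finset.range i, (s + r - j) := by
  induction i with
  | zero => simp [qP]
  | succ i ih =>
    rw [qP_expand]
    simp only [coeff_add, coeff_C_mul]
    rw [coeff_X_mul_derivative, coeff_X_mul, coeff_X_mul, coeff_X_mul_derivative,
      qP_coeff_gt s r i (i+1) (by omega), Finset.prod_range_succ, ih]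
    ring

lemma qP_natDegree (s r : ℝ) (i : ℕ) : (qP s r i).natDegree ≤ i :=
  natDegree_le_iff_coeff_eq_zero.2 (fun j hj => qP_coeff_gt s r i j hj)

/-- the weights -/
noncomputable def uF (s r : ℝ) (i : ℕ) (x : ℝ) : ℝ :=
  x ^ (s - i) * (1 + x) ^ (r - i) * (qP s r i).eval x

lemma uF_hasDerivAt (s r : ℝ) (i : ℕ) {x : ℝ} (hx : 0 < x) :
    HasDerivAt (uF s r i) (uF s r (i+1) x) x := by
  have h1 : HasDerivAt (fun y : ℝ => y ^ (s - i)) ((s - i) * x ^ (s - i - 1)) x :=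
    Real.hasDerivAt_rpow_const (Or.inl hx.ne')
  have h2 : HasDerivAt (fun y : ℝ => (1 + y) ^ (r - i)) (1 * (r - i) * (1 + x) ^ (r - i - 1)) x :=
    ((hasDerivAt_id x).const_add 1).rpow_const (Or.inl (by simp; linarith))
  have h3 := (qP s r i).hasDerivAt x
  have h := (h1.mul h2).mul h3
  refine h.congr_deriv ?_
  unfold uF
  have e1 : x ^ (s - i) = x ^ (s - i - 1) * x := by
    rw [← Real.rpow_add_one hx.ne']; congr 1; ring
  have e2 : (1 + x) ^ (r - i) = (1 + x) ^ (r - i - 1) * (1 + x) := by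
    rw [← Real.rpow_add_one (by linarith)]; congr 1; ring
  have e3 : s - ((i + 1 : ℕ) : ℝ) = s - i - 1 := by push_cast; ring
  have e4 : r - ((i + 1 : ℕ) : ℝ) = r - i - 1 := by push_cast; ring
  simp only [Pi.mul_apply]
  rw [e1, e2, e3, e4]
  simp only [qP, eval_add, eval_mul, eval_C, eval_X, eval_one]
  ring

lemma iteratedDeriv_uF (s r : ℝ) (i : ℕ) : ∀ x : ℝ, 0 < x →
    iteratedDeriv i (fun y : ℝ => y ^ s * (1 + y) ^ r) x = uF s r i x := by
  induction i with
  | zero => intro x hx; simp [uF, qP]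
  | succ i ih =>
    intro x hx
    rw [iteratedDeriv_succ]
    have : iteratedDeriv i (fun y : ℝ => y ^ s * (1 + y) ^ r) =ᶠ[𝓝 x] uF s r i := by
      filter_upwards [Ioi_mem_nhds hx] with y hy using ih y hy
    rw [this.deriv_eq, (uF_hasDerivAt s r i hx).deriv]

lemma finiteM_eq (p q : ℝ) (n : ℕ) {x : ℝ} (hx : 0 < x) :
    finiteM p q n x = (-1) ^ n * (qP (n + q) (n - p - q) n).eval x := by
  unfold finiteM
  rw [iteratedDeriv_uF _ _ _ _ hx]
  unfold uF
  have e1 : (n : ℝ) + q - n = q := by ring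
  have e2 : (n : ℝ) - p - q - n = -(p + q) := by ring
  rw [e1, e2, Real.rpow_neg hx.le, Real.rpow_neg (by linarith)]
  have := (Real.rpow_pos_of_pos hx q).ne'
  have := (Real.rpow_pos_of_pos (show 0 < 1 + x by linarith) (p+q)).ne'
  field_simp

lemma poly_bound (f : Polynomial ℝ) (N : ℕ) (hf : f.natDegree ≤ N) :
    ∃ K : ℝ, 0 ≤ K ∧ ∀ x : ℝ, 0 ≤ x → |f.eval x| ≤ K * (1 + x) ^ N := by
  refine ⟨∑ i ∈ Finset.range (N+1), |f.coeff i|, Finset.sum_nonneg fun _ _ => abs_nonneg _, ?_⟩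
  intro x hx
  rw [eval_eq_sum_range' (Nat.lt_succ_of_le hf), Finset.sum_mul]
  refine (Finset.abs_sum_le_sum_abs _ _).trans (Finset.sum_le_sum fun i hi => ?_)
  rw [abs_mul, abs_of_nonneg (pow_nonneg hx i)]
  gcongr
  calc x ^ i ≤ (1 + x) ^ i := by gcongr; linarith
    _ ≤ (1 + x) ^ N := pow_le_pow_right₀ (by linarith) (by simp at hi; omega)

lemma one_add_rpow_le (ρ : ℝ) {x : ℝ} (hx : 1 ≤ x) : (1 + x) ^ ρ ≤ 2 ^ |ρ| * x ^ ρ := by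
  have h : 1 + x = (1 + x⁻¹) * x := by field_simp; ring
  have h1 : 1 ≤ 1 + x⁻¹ := by have : 0 < x⁻¹ := by positivity
                              linarith
  have h2 : 1 + x⁻¹ ≤ 2 := by have := inv_le_one_of_one_le₀ hx
                              linarith
  rw [h, Real.mul_rpow (by linarith) (by linarith)]
  gcongr
  calc (1 + x⁻¹) ^ ρ ≤ (1 + x⁻¹) ^ |ρ| := Real.rpow_le_rpow_of_exponent_le h1 (le_abs_self _)
    _ ≤ 2 ^ |ρ| := Real.rpow_le_rpow (by linarith) h2 (abs_nonneg _)

lemma contOn_w (s r : ℝ) (f : Polynomial ℝ) :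
    ContinuousOn (fun x : ℝ => x ^ s * (1 + x) ^ r * f.eval x) (Ioi 0) := by
  intro x hx
  have hx : 0 < x := hx
  refine ContinuousAt.continuousWithinAt ?_
  refine ((Real.continuousAt_rpow_const _ _ (Or.inl hx.ne')).mul ?_).mul f.continuous.continuousAt
  exact ContinuousAt.rpow_const (by fun_prop) (Or.inl (by linarith))

lemma bound_infty (s r : ℝ) (f : Polynomial ℝ) (N : ℕ) (hf : f.natDegree ≤ N) :
    ∃ K : ℝ, ∀ x : ℝ, 1 ≤ x → |x ^ s * (1 + x) ^ r * f.eval x| ≤ K * x ^ (s + r + N) := by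
  obtain ⟨K, hK, h⟩ := poly_bound f N hf
  refine ⟨K * 2 ^ |r + N|, fun x hx => ?_⟩
  have hx0 : 0 < x := by linarith
  have h1 := one_add_rpow_le (r + N) hx
  rw [abs_mul, abs_of_nonneg (by positivity)]
  calc x ^ s * (1 + x) ^ r * |f.eval x| ≤ x ^ s * (1 + x) ^ r * (K * (1 + x) ^ N) := by
        gcongr; exact h x hx0.le
    _ = K * x ^ s * (1 + x) ^ (r + N) := by
        rw [Real.rpow_add_natCast (by linarith)]; ring
    _ ≤ K * x ^ s * (2 ^ |r + N| * x ^ (r + N)) := by gcongr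
    _ = K * 2 ^ |r + N| * x ^ (s + r + N) := by
        rw [add_assoc, Real.rpow_add hx0 s]; ring

lemma integrable_w (s r : ℝ) (f : Polynomial ℝ) (N : ℕ) (hf : f.natDegree ≤ N)
    (hs : -1 < s) (hN : s + r + N < -1) :
    IntegrableOn (fun x : ℝ => x ^ s * (1 + x) ^ r * f.eval x) (Ioi 0) := by
  rw [← Ioc_union_Ioi_eq_Ioi (zero_le_one' ℝ)]
  refine IntegrableOn.union ?_ ?_
  · have h1 : IntervalIntegrable (fun x : ℝ => x ^ s) volume 0 1 :=
      intervalIntegral.intervalIntegrable_rpow' hs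
    have h2 : ContinuousOn (fun x : ℝ => (1 + x) ^ r * f.eval x) (uIcc 0 1) := by
      refine ContinuousOn.mul ?_ f.continuous.continuousOn
      refine ContinuousOn.rpow_const (by fun_prop) ?_
      intro x hx
      rw [uIcc_of_le zero_le_one] at hx
      left; linarith [hx.1]
    have := h1.mul_continuousOn h2
    rw [intervalIntegrable_iff_integrableOn_Ioc_of_le zero_le_one] at this
    simpa only [mul_assoc] using this
  · obtain ⟨K, hK⟩ := bound_infty s r f N hf
    refine Integrable.mono' ((integrableOn_Ioi_rpow_of_lt hN zero_lt_one).const_mul K) ?_ ?_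
    · exact ((contOn_w s r f).mono (Ioi_subset_Ioi zero_le_one)).aestronglyMeasurable
        measurableSet_Ioi
    · filter_upwards [ae_restrict_mem measurableSet_Ioi] with x hx
      exact hK x (le_of_lt hx)

lemma tendsto_w_infty (s r : ℝ) (f : Polynomial ℝ) (N : ℕ) (hf : f.natDegree ≤ N)
    (hN : s + r + N < 0) :
    Tendsto (fun x : ℝ => x ^ s * (1 + x) ^ r * f.eval x) atTop (𝓝 0) := by
  obtain ⟨K, hK⟩ := bound_infty s r f N hf
  refine squeeze_zero_norm' (a := fun x => K * x ^ (s + r + N)) ?_ ?_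
  · filter_upwards [eventually_ge_atTop 1] with x hx using hK x hx
  · have := (tendsto_rpow_neg_atTop (y := -(s + r + N)) (by linarith)).const_mul K
    simpa using this

lemma tendsto_w_zero (s r : ℝ) (f : Polynomial ℝ) (hs : 0 < s) :
    Tendsto (fun x : ℝ => x ^ s * (1 + x) ^ r * f.eval x) (𝓝[>] 0) (𝓝 0) := by
  have : ContinuousAt (fun x : ℝ => x ^ s * (1 + x) ^ r * f.eval x) 0 := by
    refine ((Real.continuousAt_rpow_const _ _ (Or.inr hs.le)).mul ?_).mul f.continuous.continuousAt
    exact ContinuousAt.rpow_const (by fun_prop) (Or.inl (by simp))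
  have h := this.tendsto
  simp only [Real.zero_rpow hs.ne', zero_mul] at h
  exact h.mono_left nhdsWithin_le_nhds

lemma ibp (s r : ℝ) (i : ℕ) (f : Polynomial ℝ) (hf : f.natDegree ≤ i + 1)
    (hs : -1 < s - (i + 1)) (hsr : s + r < -1) :
    ∫ x in Ioi (0:ℝ), f.eval x * uF s r (i+1) x =
      - ∫ x in Ioi (0:ℝ), (derivative f).eval x * uF s r i x := by
  have hd : (derivative f).natDegree ≤ i := (natDegree_derivative_le f).trans (by omega)
  have := integral_Ioi_mul_deriv_eq_deriv_mul (a := 0) (u := fun x => f.eval x)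
    (u' := fun x => (derivative f).eval x) (v := uF s r i) (v' := uF s r (i+1)) (a' := 0) (b' := 0)
    (fun x _ => f.hasDerivAt x) (fun x hx => uF_hasDerivAt s r i hx) ?_ ?_ ?_ ?_
  · simpa using this
  · have := integrable_w (s - ((i+1 : ℕ) : ℝ)) (r - ((i+1 : ℕ) : ℝ)) (qP s r (i+1) * f) (2 * (i+1))
      (natDegree_mul_le.trans (by have := qP_natDegree s r (i+1); omega))
      (by push_cast; linarith) (by push_cast; linarith)
    refine this.congr_fun (fun x hx => ?_) measurableSet_Ioi
    simp only [uF, eval_mul, Pi.mul_apply]; ring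
  · have := integrable_w (s - i) (r - i) (qP s r i * derivative f) (2 * i)
      (natDegree_mul_le.trans (by have := qP_natDegree s r i; omega))
      (by linarith) (by push_cast; linarith)
    refine this.congr_fun (fun x hx => ?_) measurableSet_Ioi
    simp only [uF, eval_mul, Pi.mul_apply]; ring
  · have := tendsto_w_zero (s - i) (r - i) (qP s r i * f) (by linarith)
    refine this.congr (fun x => ?_)
    simp only [uF, eval_mul, Pi.mul_apply]; ring
  · have := tendsto_w_infty (s - i) (r - i) (qP s r i * f) (2 * i + 1)
      (natDegree_mul_le.trans (by have := qP_natDegree s r i; omega))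
      (by push_cast; linarith)
    refine this.congr (fun x => ?_)
    simp only [uF, eval_mul, Pi.mul_apply]; ring

lemma ibp_all (s r : ℝ) (i : ℕ) : ∀ (f : Polynomial ℝ) (_ : f.natDegree ≤ i)
    (_ : -1 < s - i) (_ : s + r < -1),
    ∫ x in Ioi (0:ℝ), f.eval x * uF s r i x =
      (-1) ^ i * (i.factorial * f.coeff i) * ∫ x in Ioi (0:ℝ), x ^ s * (1 + x) ^ r := by
  induction i with
  | zero =>
    intro f hf hs hsr
    obtain ⟨c, rfl⟩ : ∃ c, f = C c := ⟨_, eq_C_of_natDegree_le_zero hf⟩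
    simp [uF, qP, integral_const_mul]
  | succ i ih =>
    intro f hf hs hsr
    push_cast at hs
    rw [ibp s r i f hf hs hsr, ih (derivative f) ((natDegree_derivative_le f).trans (by omega))
      (by linarith) hsr, coeff_derivative, Nat.factorial_succ]
    push_cast
    ring

lemma beta_Ioi (u v : ℝ) (hu : 0 < u) (hv : 0 < v) :
    ∫ x in Ioi (0:ℝ), x ^ (u - 1) * (1 + x) ^ (-(u + v)) =
      Real.Gamma u * Real.Gamma v / Real.Gamma (u + v) := by
  have hb : Real.Gamma u * Real.Gamma v / Real.Gamma (u + v) =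
      ∫ x in Ioo (0:ℝ) 1, x ^ (u - 1) * (1 - x) ^ (v - 1) := by
    have := ProbabilityTheory.beta_eq_betaIntegralReal u v hu hv
    rw [ProbabilityTheory.beta] at this
    rw [this, Complex.betaIntegral, intervalIntegral.integral_of_le zero_le_one,
      ← integral_Ioc_eq_integral_Ioo]
    have h2 : ∀ x ∈ Ioc (0:ℝ) 1, (x:ℂ) ^ ((u:ℂ) - 1) * (1 - (x:ℂ)) ^ ((v:ℂ) - 1) =
        ((x ^ (u - 1) * (1 - x) ^ (v - 1) : ℝ) : ℂ) := by
      intro x hx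
      rw [Complex.ofReal_mul, Complex.ofReal_cpow hx.1.le, Complex.ofReal_cpow (by linarith [hx.2])]
      push_cast; rfl
    rw [setIntegral_congr_fun measurableSet_Ioc h2]
    rw [integral_complex_ofReal, Complex.ofReal_re]
  rw [hb]
  have him : (fun x : ℝ => x / (1 - x)) '' Ioo 0 1 = Ioi 0 := by
    ext y
    constructor
    · rintro ⟨x, hx, rfl⟩
      exact div_pos hx.1 (by linarith [hx.2])
    · intro hy
      have hy : 0 < y := hy
      refine ⟨y / (1 + y), ⟨by positivity, ?_⟩, ?_⟩
      · rw [div_lt_one (by linarith)]; linarith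
      · have : 1 + y ≠ 0 := by linarith
        field_simp
        ring
  rw [← him, integral_image_eq_integral_abs_deriv_smul (f' := fun x => 1 / (1 - x) ^ 2)
    measurableSet_Ioo]
  · refine setIntegral_congr_fun measurableSet_Ioo fun x hx => ?_
    have h0 : 0 < x := hx.1
    have h1 : 0 < 1 - x := by linarith [hx.2]
    have e : 1 + x / (1 - x) = (1 - x)⁻¹ := by field_simp; ring
    simp only [smul_eq_mul]
    rw [e, abs_of_nonneg (by positivity), Real.div_rpow h0.le h1.le, Real.inv_rpow h1.le,
      Real.rpow_neg h1.le, inv_inv]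
    have e2 : (1 - x) ^ (u + v) = (1 - x) ^ (u - 1) * (1 - x) ^ (v - 1) * (1 - x) ^ 2 := by
      rw [← Real.rpow_add h1, ← Real.rpow_natCast, ← Real.rpow_add h1]; congr 1; push_cast; ring
    rw [e2]
    have := (Real.rpow_pos_of_pos h1 (u - 1)).ne'
    field_simp
  · intro x hx
    have h1 : 1 - x ≠ 0 := by linarith [hx.2]
    have := ((hasDerivAt_id x).div ((hasDerivAt_id x).const_sub 1) h1).hasDerivWithinAt (s := Ioo 0 1)
    refine this.congr_deriv ?_
    simp
  · intro x hx y hy h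
    have h1 : 1 - x ≠ 0 := by linarith [hx.2]
    have h2 : 1 - y ≠ 0 := by linarith [hy.2]
    simp only at h
    rw [div_eq_div_iff h1 h2] at h
    linarith

/-- One-dimensional integrals. -/
lemma oneD (a b : ℝ) (k k' : ℕ) (hk : k' ≤ k) (ha : 2 * (k:ℝ) + 1 < a) (hb : -1 < b) :
    ∫ t in Ioi (0:ℝ), finiteM a b k t * finiteM a b k' t * (t ^ b * (1 + t) ^ (-(a + b))) =
      (-1) ^ k' * (k.factorial * (qP (k' + b) (k' - a - b) k').coeff k) *
        (Real.Gamma (k + b + 1) * Real.Gamma (a - 2 * k - 1) / Real.Gamma (a + b - k)) := by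
  have h := ibp_all (k + b) (k - a - b) k (qP (k' + b) (k' - a - b) k')
    ((qP_natDegree _ _ _).trans hk) (by linarith) (by linarith)
  have hk0 : (0:ℝ) ≤ k := Nat.cast_nonneg k
  have hB := beta_Ioi (k + b + 1) (a - 2 * k - 1) (by linarith) (by linarith)
  have e1 : (k:ℝ) + b + 1 + (a - 2 * k - 1) = a + b - k := by ring
  have e2 : (k:ℝ) + b + 1 - 1 = k + b := by ring
  have e3 : -(a + b - (k:ℝ)) = k - a - b := by ring
  rw [e1, e2, e3] at hB
  rw [hB] at h
  have h2 : ∀ t ∈ Ioi (0:ℝ), finiteM a b k t * finiteM a b k' t * (t ^ b * (1 + t) ^ (-(a + b))) =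
      ((-1) ^ k * (-1) ^ k') * ((qP (k' + b) (k' - a - b) k').eval t *
        uF (k + b) (k - a - b) k t) := by
    intro t ht
    rw [finiteM_eq _ _ _ ht, finiteM_eq _ _ _ ht, uF]
    have e4 : (k:ℝ) + b - k = b := by ring
    have e5 : (k:ℝ) - a - b - k = -(a + b) := by ring
    rw [e4, e5]; ring
  rw [setIntegral_congr_fun measurableSet_Ioi h2, integral_const_mul, h]
  have e6 : ((-1:ℝ) ^ k) * (-1) ^ k = 1 := by rw [← mul_pow]; simp
  linear_combination ((-1) ^ k' * (k.factorial * (qP (k' + b) (k' - a - b) k').coeff k) *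
        (Real.Gamma (k + b + 1) * Real.Gamma (a - 2 * k - 1) / Real.Gamma (a + b - k))) * e6

lemma oneD_lt (a b : ℝ) (k k' : ℕ) (hk : k' < k) (ha : 2 * (k:ℝ) + 1 < a) (hb : -1 < b) :
    ∫ t in Ioi (0:ℝ), finiteM a b k t * finiteM a b k' t * (t ^ b * (1 + t) ^ (-(a + b))) = 0 := by
  rw [oneD a b k k' hk.le ha hb, qP_coeff_gt _ _ _ _ hk]
  simp

lemma oneD_ne (a b : ℝ) (k k' : ℕ) (hk : k ≠ k') (ha : 2 * (k:ℝ) + 1 < a)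
    (ha' : 2 * (k':ℝ) + 1 < a) (hb : -1 < b) :
    ∫ t in Ioi (0:ℝ), finiteM a b k t * finiteM a b k' t * (t ^ b * (1 + t) ^ (-(a + b))) = 0 := by
  rcases lt_or_gt_of_ne hk with h | h
  · have := oneD_lt a b k' k h ha' hb
    simpa only [mul_comm (finiteM a b k' _)] using this
  · exact oneD_lt a b k k' h ha hb

lemma gamma_asc (x : ℝ) (hx : 0 < x) (n : ℕ) :
    Real.Gamma (x + n) = (ascPochhammer ℝ n).eval x * Real.Gamma x := by
  induction n with
  | zero => simp
  | succ n ih =>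
    have : x + ((n + 1 : ℕ) : ℝ) = (x + n) + 1 := by push_cast; ring
    rw [this, Real.Gamma_add_one (by positivity), ih, ascPochhammer_succ_eval]
    ring

lemma prod_gamma (a : ℝ) (k : ℕ) (i : ℕ) (ha : 0 < a - 2 * k) :
    (-1) ^ i * (∏ j ∈ Finset.range i, (2 * (k:ℝ) - a - j)) * Real.Gamma (a - 2 * k) =
      Real.Gamma (a - 2 * k + i) := by
  induction i with
  | zero => simp
  | succ n ih =>
    have : a - 2 * k + ((n + 1 : ℕ) : ℝ) = (a - 2 * k + n) + 1 := by push_cast; ring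
    rw [this, Real.Gamma_add_one (by positivity), ← ih, Finset.prod_range_succ]
    ring

lemma oneD_eq (a b : ℝ) (k : ℕ) (ha : 2 * (k:ℝ) + 1 < a) (hb : -1 < b) :
    cM a b * ∫ t in Ioi (0:ℝ), finiteM a b k t * finiteM a b k t * (t ^ b * (1 + t) ^ (-(a + b))) =
      hM a b k := by
  have hk0 : (0:ℝ) ≤ k := Nat.cast_nonneg k
  rw [oneD a b k k le_rfl ha hb, qP_coeff_self]
  have e : (k:ℝ) + b + (k - a - b) = 2 * k - a := by ring
  rw [e]
  have h1 := prod_gamma a k k (by linarith)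
  have h2 := gamma_asc (b + 1) (by linarith) k
  have h3 : Real.Gamma (a - 2 * k) = (a - 2 * k - 1) * Real.Gamma (a - 2 * k - 1) := by
    rw [← Real.Gamma_add_one (by linarith)]; congr 1; ring
  have e1 : a - 2 * (k:ℝ) + k = a - k := by ring
  have e2 : b + 1 + (k:ℝ) = k + b + 1 := by ring
  rw [e1, h3] at h1
  rw [e2] at h2
  unfold cM hM
  have n1 := (Real.Gamma_pos_of_pos (show 0 < a - 1 by linarith)).ne'
  have n2 := (Real.Gamma_pos_of_pos (show 0 < b + 1 by linarith)).ne'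
  have n3 := (Real.Gamma_pos_of_pos (show 0 < a + b - k by linarith)).ne'
  have n4 : a - 2 * (k:ℝ) - 1 ≠ 0 := by linarith
  rw [h2, ← h1]
  field_simp

/-- derivative of the cone map -/
noncomputable def coneD {E : Type*} [NormedAddCommGroup E] [NormedSpace ℝ E] (z : E × ℝ) :
    (E × ℝ) →L[ℝ] (E × ℝ) :=
  (z.2 • ContinuousLinearMap.fst ℝ E ℝ + (ContinuousLinearMap.snd ℝ E ℝ).smulRight z.1).prod
    (ContinuousLinearMap.snd ℝ E ℝ)

lemma coneD_hasFDerivAt {E : Type*} [NormedAddCommGroup E] [NormedSpace ℝ E] (z : E × ℝ) :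
    HasFDerivAt (fun w : E × ℝ => (w.2 • w.1, w.2)) (coneD z) z :=
  HasFDerivAt.prodMk (hasFDerivAt_snd.smul hasFDerivAt_fst) hasFDerivAt_snd

lemma coneD_det {E : Type*} [NormedAddCommGroup E] [NormedSpace ℝ E] [FiniteDimensional ℝ E]
    (z : E × ℝ) : (coneD z).det = z.2 ^ Module.finrank ℝ E := by
  have : ((coneD z : (E × ℝ) →L[ℝ] (E × ℝ)) : (E × ℝ) →ₗ[ℝ] (E × ℝ)) =
      (LinearMap.transvection (LinearMap.snd ℝ E ℝ) (z.1, (0:ℝ))) ∘ₗ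
        (LinearMap.prodMap (z.2 • LinearMap.id) LinearMap.id) := by
    ext v <;> simp [coneD, LinearMap.transvection]
  rw [ContinuousLinearMap.det, this, LinearMap.det_comp, LinearMap.transvection.det,
    LinearMap.det_prodMap]
  simp

lemma cone_integral (d : ℕ) (G : EuclideanSpace ℝ (Fin d) × ℝ → ℝ)
    (f : EuclideanSpace ℝ (Fin d) → ℝ) (g : ℝ → ℝ)
    (hG : ∀ y : EuclideanSpace ℝ (Fin d), ‖y‖ ≤ 1 → ∀ t : ℝ, 0 < t →
      t ^ d * G (t • y, t) = f y * g t) :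
    ∫ z in {z : EuclideanSpace ℝ (Fin d) × ℝ | ‖z.1‖ ≤ z.2}, G z =
      (∫ y in Metric.closedBall (0 : EuclideanSpace ℝ (Fin d)) 1, f y) *
        ∫ t in Ioi (0:ℝ), g t := by
  have him : (fun w : EuclideanSpace ℝ (Fin d) × ℝ => (w.2 • w.1, w.2)) ''
      (Metric.closedBall 0 1 ×ˢ Ioi 0) = {z | ‖z.1‖ ≤ z.2 ∧ 0 < z.2} := by
    ext ⟨x, t⟩
    constructor
    · rintro ⟨⟨y, s⟩, ⟨hy, hs⟩, h⟩
      simp only [mem_Ioi, mem_closedBall_zero_iff, Prod.mk.injEq] at hy hs h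
      obtain ⟨rfl, rfl⟩ := h
      refine ⟨?_, hs⟩
      simp only [norm_smul, Real.norm_eq_abs, abs_of_pos hs]
      nlinarith
    · rintro ⟨h1, h2⟩
      simp only at h1 h2
      refine ⟨(t⁻¹ • x, t), ⟨?_, h2⟩, ?_⟩
      · simp only [mem_closedBall_zero_iff, norm_smul, norm_inv, Real.norm_eq_abs, abs_of_pos h2]
        rw [inv_mul_le_one₀ h2]; exact h1
      · simp [smul_smul, h2.ne']
  have hae : ({z : EuclideanSpace ℝ (Fin d) × ℝ | ‖z.1‖ ≤ z.2} : Set _) =ᵐ[volume]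
      {z | ‖z.1‖ ≤ z.2 ∧ 0 < z.2} := by
    have h0 : ∀ᵐ z : EuclideanSpace ℝ (Fin d) × ℝ, z.2 ≠ 0 := by
      have : (volume : Measure (EuclideanSpace ℝ (Fin d) × ℝ)) (Prod.snd ⁻¹' {0}) = 0 :=
        Measure.quasiMeasurePreserving_snd.preimage_null (by simp)
      rw [ae_iff]
      convert! this using 2
      ext z; simp
    filter_upwards [h0] with z hz
    refine propext ⟨fun h => ⟨h, lt_of_le_of_ne ((norm_nonneg _).trans h) hz.symm⟩, fun h => h.1⟩
  rw [setIntegral_congr_set hae, ← him]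
  have hms : MeasurableSet (Metric.closedBall (0 : EuclideanSpace ℝ (Fin d)) 1 ×ˢ Ioi (0:ℝ)) :=
    Metric.isClosed_closedBall.measurableSet.prod measurableSet_Ioi
  rw [Measure.volume_eq_prod, integral_image_eq_integral_abs_det_fderiv_smul _ hms
    (fun z _ => (coneD_hasFDerivAt z).hasFDerivWithinAt), ← setIntegral_prod_mul]
  · refine setIntegral_congr_fun hms fun z hz => ?_
    have h1 : ‖z.1‖ ≤ 1 := by simpa using hz.1
    have h2 : 0 < z.2 := hz.2
    simp only [smul_eq_mul]
    rw [coneD_det, finrank_euclideanSpace_fin, abs_of_pos (by positivity)]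
    exact hG z.1 h1 z.2 h2
  · rintro ⟨y, t⟩ hz ⟨y', t'⟩ hz' h
    simp only [Prod.mk.injEq] at h
    obtain ⟨h1, rfl⟩ := h
    have : t ≠ 0 := ne_of_gt hz.2
    rw [smul_right_injective _ this h1]

end BallM

theorem stmt0 (d : ℕ) (hd : 1 ≤ d) (μ : ℝ) (hμ : -1/2 < μ)
    (α : ℝ) (hα : α = μ + ((d : ℝ) - 1) / 2)
    (m n m' n' : ℕ) (hmn : m ≤ n) (hmn' : m' ≤ n') (p q : ℝ)
    (hp : 2 * ((max n n' : ℕ) : ℝ) + 2 * μ + d < p) (hq : -2 * μ - d < q)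
    (P P' : EuclideanSpace ℝ (Fin d) → ℝ)
    (hP : IsBallOrtho d μ m P) (hP' : IsBallOrtho d μ m' P') :
    (ballB d μ * cM (p - 2 * α) (q + 2 * α)) *
      ∫ z in {z : EuclideanSpace ℝ (Fin d) × ℝ | ‖z.1‖ ≤ z.2},
        (finiteM (p - 2 * α - 2 * m) (q + 2 * α + 2 * m) (n - m) z.2 * z.2 ^ m *
            P (z.2⁻¹ • z.1)) *
        (finiteM (p - 2 * α - 2 * m') (q + 2 * α + 2 * m') (n' - m') z.2 * z.2 ^ m' *
            P' (z.2⁻¹ • z.1)) *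
        ((z.2 ^ 2 - ‖z.1‖ ^ 2) ^ (μ - 1/2) * z.2 ^ q * (1 + z.2) ^ (-(p + q))) =
    if n = n' ∧ m = m' then
      (cM (p - 2 * α) (q + 2 * α) / cM (p - 2 * α - 2 * m) (q + 2 * α + 2 * m)) *
        hM (p - 2 * α - 2 * m) (q + 2 * α + 2 * m) (n - m) *
        (ballB d μ *
          ∫ y in Metric.closedBall (0 : EuclideanSpace ℝ (Fin d)) 1,
            P y * P' y * (1 - ‖y‖ ^ 2) ^ (μ - 1/2))
    else 0 := by
  have hd0 : (1:ℝ) ≤ d := by exact_mod_cast hd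
  have hn1 : (n:ℝ) ≤ ((max n n' : ℕ) : ℝ) := by exact_mod_cast le_max_left n n'
  have hn2 : (n':ℝ) ≤ ((max n n' : ℕ) : ℝ) := by exact_mod_cast le_max_right n n'
  have hm0 : (0:ℝ) ≤ m := Nat.cast_nonneg m
  have hc := BallM.cone_integral d (fun z =>
        (finiteM (p - 2 * α - 2 * m) (q + 2 * α + 2 * m) (n - m) z.2 * z.2 ^ m *
            P (z.2⁻¹ • z.1)) *
        (finiteM (p - 2 * α - 2 * m') (q + 2 * α + 2 * m') (n' - m') z.2 * z.2 ^ m' *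
            P' (z.2⁻¹ • z.1)) *
        ((z.2 ^ 2 - ‖z.1‖ ^ 2) ^ (μ - 1/2) * z.2 ^ q * (1 + z.2) ^ (-(p + q))))
      (fun y => P y * P' y * (1 - ‖y‖ ^ 2) ^ (μ - 1/2))
      (fun t => finiteM (p - 2 * α - 2 * m) (q + 2 * α + 2 * m) (n - m) t *
        finiteM (p - 2 * α - 2 * m') (q + 2 * α + 2 * m') (n' - m') t *
        (t ^ (q + 2 * α + m + m') * (1 + t) ^ (-(p + q)))) ?_
  swap
  · intro y hy t ht
    simp only [smul_smul, inv_mul_cancel₀ ht.ne', one_smul, norm_smul, Real.norm_eq_abs,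
      abs_of_pos ht]
    have e1 : t ^ 2 - (t * ‖y‖) ^ 2 = t ^ 2 * (1 - ‖y‖ ^ 2) := by ring
    have h1 : 0 ≤ 1 - ‖y‖ ^ 2 := by nlinarith [norm_nonneg y]
    rw [e1, Real.mul_rpow (by positivity) h1]
    have e2 : t ^ (q + 2 * α + m + m') = t ^ d * (t ^ 2) ^ (μ - 1/2) * t ^ q * t ^ m * t ^ m' := by
      rw [← Real.rpow_natCast t 2, ← Real.rpow_mul ht.le, ← Real.rpow_natCast t d,
        ← Real.rpow_natCast t m, ← Real.rpow_natCast t m', ← Real.rpow_add ht, ← Real.rpow_add ht,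
        ← Real.rpow_add ht, ← Real.rpow_add ht]
      congr 1
      rw [hα]; push_cast; ring
    rw [e2]; ring
  rw [hc]
  by_cases hmm : m = m'
  · subst hmm
    have e : ∀ t : ℝ, t ^ (q + 2 * α + m + m) * (1 + t) ^ (-(p + q)) =
        t ^ (q + 2 * α + 2 * m) *
          (1 + t) ^ (-((p - 2 * α - 2 * m) + (q + 2 * α + 2 * m))) := by
      intro t
      congr 2 <;> ring
    simp only [e]
    have hb : -1 < q + 2 * α + 2 * m := by rw [hα]; linarith
    have ha : 2 * ((n - m : ℕ) : ℝ) + 1 < p - 2 * α - 2 * m := by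
      rw [Nat.cast_sub hmn, hα]; linarith
    have ha' : 2 * ((n' - m : ℕ) : ℝ) + 1 < p - 2 * α - 2 * m := by
      rw [Nat.cast_sub hmn', hα]; linarith
    by_cases hnn : n = n'
    · subst hnn
      rw [if_pos (by simp), ← BallM.oneD_eq _ _ _ ha hb]
      have hk0 : (0:ℝ) ≤ ((n - m : ℕ) : ℝ) := Nat.cast_nonneg _
      have hcne : cM (p - 2 * α - 2 * m) (q + 2 * α + 2 * m) ≠ 0 := by
        unfold cM
        have n1 := Real.Gamma_pos_of_pos (show 0 < p - 2 * α - 2 * m - 1 by linarith)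
        have n2 := Real.Gamma_pos_of_pos (show 0 < q + 2 * α + 2 * m + 1 by linarith)
        have n3 := Real.Gamma_pos_of_pos
          (show 0 < p - 2 * α - 2 * m + (q + 2 * α + 2 * m) by linarith)
        positivity
      field_simp
    · rw [if_neg (fun h => hnn h.1), BallM.oneD_ne _ _ _ _ (by omega) ha ha' hb]
      simp
  · rw [if_neg (fun h => hmm h.2)]
    have hz : ∫ y in Metric.closedBall (0 : EuclideanSpace ℝ (Fin d)) 1,
        P y * P' y * (1 - ‖y‖ ^ 2) ^ (μ - 1/2) = 0 := by
      obtain ⟨Q, hQd, hQ, hQo⟩ := hP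
      obtain ⟨Q', hQd', hQ', hQo'⟩ := hP'
      rcases lt_or_gt_of_ne hmm with h | h
      · rw [← hQo' Q (by omega)]
        simp only [← hQ, mul_comm (P _)]
      · rw [← hQo Q' (by omega)]
        simp only [← hQ']
    rw [hz]
    simp
end

section
/- Let d ≥ 1 be an integer, μ > −1/2, m ≤ n natural numbers, and p a real number. Let f(t) = M_{n−m}^{(p−2m−2μ−d+1, 2m+2μ+d−1)}(t) and let H be as in the context (homogeneous of degree m and satisfying the ball-type equation with parameter μ). Set v(x,t) = f(t)H(x,t). Then for all (x,t) with t > 0: t(1+t)∂_t²v + 2(1+t)⟨x,∇_x⟩∂_t v + ( d+2μ+(−p+2μ+d+1)t )∂_t v + t(1+t)Δ_x v − ( t²Δ_x v − ⟨x,∇_x⟩²v − (2μ+d−p)⟨x,∇_x⟩v ) = n(n−p+2μ+d) v. -/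
open Real

/-- Partial derivative in the `i`-th coordinate direction. -/
noncomputable def pdx {d : ℕ} (i : Fin d) (f : (Fin d → ℝ) → ℝ) : (Fin d → ℝ) → ℝ :=
  fun x => fderiv ℝ f x (Pi.single i 1)

/-- The Laplacian `Δ_x = Σ_i ∂²/∂x_i²` in the `x` variable. -/
noncomputable def lapx {d : ℕ} (f : (Fin d → ℝ) → ℝ) : (Fin d → ℝ) → ℝ :=
  fun x => ∑ i : Fin d, pdx i (pdx i f) x

/-- The operator `⟨x,∇_x⟩ = Σ_i x_i ∂/∂x_i`. -/
noncomputable def xgrad {d : ℕ} (f : (Fin d → ℝ) → ℝ) : (Fin d → ℝ) → ℝ :=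
  fun x => ∑ i : Fin d, x i * pdx i f x

lemma hasDerivAt_pw (α β y : ℝ) (hy : 0 < y) :
    HasDerivAt (fun y : ℝ => y ^ α * (1 + y) ^ β)
      ((α / y + β / (1 + y)) * (y ^ α * (1 + y) ^ β)) y := by
  have h1 : HasDerivAt (fun y : ℝ => y ^ α) (α * y ^ (α - 1)) y :=
    Real.hasDerivAt_rpow_const (Or.inl hy.ne')
  have h2 : HasDerivAt (fun y : ℝ => (1 + y) ^ β) (1 * β * (1 + y) ^ (β - 1)) y :=
    ((hasDerivAt_id' y).const_add 1).rpow_const (Or.inl (by positivity))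
  have hy1 : (0 : ℝ) < 1 + y := by positivity
  refine (h1.mul h2).congr_deriv ?_
  rw [Real.rpow_sub_one hy.ne', Real.rpow_sub_one hy1.ne']
  field_simp

lemma hasDerivAt_iter_pw (α β : ℝ) (j : ℕ) (y : ℝ) (hy : 0 < y) :
    HasDerivAt (iteratedDeriv j (fun y : ℝ => y ^ α * (1 + y) ^ β))
      (iteratedDeriv (j + 1) (fun y : ℝ => y ^ α * (1 + y) ^ β) y) y := by
  have hA : ∀ j : ℕ, AnalyticAt ℝ (iteratedDeriv j (fun y : ℝ => y ^ α * (1 + y) ^ β)) y := by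
    intro j
    induction j with
    | zero =>
      rw [iteratedDeriv_zero]
      have hy1 : (0 : ℝ) < 1 + y := by positivity
      refine (AnalyticAt.mul ?_ ?_)
      · exact (Real.contDiffAt_rpow_const_of_ne (n := ⊤) hy.ne').analyticAt
      · have h1 : ContDiffAt ℝ ⊤ (fun z : ℝ => 1 + z) y := by fun_prop
        exact (h1.rpow_const_of_ne hy1.ne').analyticAt
    | succ j ih =>
      rw [iteratedDeriv_succ]
      exact ih.deriv
  rw [iteratedDeriv_succ]
  exact (hA j).differentiableAt.hasDerivAt

lemma iter_pw_rec (α β : ℝ) (j : ℕ) : ∀ y : ℝ, 0 < y →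
    y * (1 + y) * iteratedDeriv (j + 2) (fun y : ℝ => y ^ α * (1 + y) ^ β) y
    + ((j + 1) * (1 + 2 * y) - α - (α + β) * y) *
        iteratedDeriv (j + 1) (fun y : ℝ => y ^ α * (1 + y) ^ β) y
    + (j + 1) * (j - (α + β)) * iteratedDeriv j (fun y : ℝ => y ^ α * (1 + y) ^ β) y = 0 := by
  have key := hasDerivAt_iter_pw α β
  have h0 : ∀ y : ℝ, 0 < y →
      y * (1 + y) * iteratedDeriv 1 (fun y : ℝ => y ^ α * (1 + y) ^ β) y
      + (- α - (α + β) * y) * iteratedDeriv 0 (fun y : ℝ => y ^ α * (1 + y) ^ β) y = 0 := by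
    intro y hy
    have hy1 : (0 : ℝ) < 1 + y := by positivity
    rw [iteratedDeriv_one, (hasDerivAt_pw α β y hy).deriv, iteratedDeriv_zero]
    field_simp
    ring
  generalize hD : (fun j => iteratedDeriv j (fun y : ℝ => y ^ α * (1 + y) ^ β)) = D at *
  have hD' : ∀ j, iteratedDeriv j (fun y : ℝ => y ^ α * (1 + y) ^ β) = D j := fun j => by
    rw [← hD]
  simp only [hD'] at *
  have step : ∀ (a0 a1 c : ℝ) (F G E : ℝ → ℝ) (F' G' E' : ℝ) (y : ℝ), 0 < y →
      HasDerivAt F F' y → HasDerivAt G G' y → HasDerivAt E E' y →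
      (∀ y, 0 < y → y * (1 + y) * F y + (a0 + a1 * y) * G y + c * E y = 0) →
      y * (1 + y) * F' + (1 + 2 * y) * F y + (a0 + a1 * y) * G' + a1 * G y + c * E' = 0 := by
    intro a0 a1 c F G E F' G' E' y hy hF hG hE h
    have hid := hasDerivAt_id' y
    have d1 := (((hid.mul (hid.const_add 1)).mul hF).add
      (((hid.const_mul a1).const_add a0).mul hG)).add (hE.const_mul c)
    have d2 := d1.congr_of_eventuallyEq (f₁ := fun _ => (0 : ℝ)) (by
      filter_upwards [lt_mem_nhds hy] with z hz
      simpa using (h z hz).symm)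
    have := d2.unique (hasDerivAt_const y (0 : ℝ))
    simp at this
    linear_combination this
  induction j with
  | zero =>
    intro y hy
    have := step (-α) (-(α + β)) 0 (D 1) (D 0) (D 0) _ _ _ y hy (key 1 y hy) (key 0 y hy)
      (key 0 y hy) (fun z hz => by linear_combination h0 z hz)
    simp at this ⊢
    linear_combination this
  | succ j ih =>
    intro y hy
    have := step (j + 1 - α) (2 * (j + 1) - (α + β)) ((j + 1) * (j - (α + β)))
      (D (j + 2)) (D (j + 1)) (D j) _ _ _ y hy (key (j + 2) y hy) (key (j + 1) y hy)
      (key j y hy) (fun z hz => by linear_combination ih z hz)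
    have e1 : j + 1 + 2 = j + 2 + 1 := by ring
    have e2 : j + 1 + 1 = j + 2 := by ring
    rw [e1, e2]
    push_cast at this ⊢
    linear_combination this

lemma finiteM_ode (P Q : ℝ) (k : ℕ) : ∃ f1 f2 : ℝ → ℝ,
    (∀ t, 0 < t → HasDerivAt (finiteM P Q k) (f1 t) t) ∧
    (∀ t, 0 < t → HasDerivAt f1 (f2 t) t) ∧
    ∀ t, 0 < t → t * (1 + t) * f2 t + ((2 - P) * t + Q + 1) * f1 t
      = k * (k + 1 - P) * finiteM P Q k t := by
  have key := hasDerivAt_iter_pw (k + Q) (k - P - Q)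
  have hrec := iter_pw_rec (k + Q) (k - P - Q) k
  have hf : ∀ x, finiteM P Q k x = (-1 : ℝ) ^ k * ((x ^ (-Q) * (1 + x) ^ (P + Q)) *
    iteratedDeriv k (fun y : ℝ => y ^ ((k : ℝ) + Q) * (1 + y) ^ ((k : ℝ) - P - Q)) x) := by
    intro x; unfold finiteM; ring
  have hfe := funext hf
  rw [hfe]
  generalize hD : (fun j => iteratedDeriv j
    (fun y : ℝ => y ^ ((k : ℝ) + Q) * (1 + y) ^ ((k : ℝ) - P - Q))) = D at *
  have hD' : ∀ j, iteratedDeriv j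
    (fun y : ℝ => y ^ ((k : ℝ) + Q) * (1 + y) ^ ((k : ℝ) - P - Q)) = D j := fun j => by
    rw [← hD]
  simp only [hD'] at *
  have hρ := hasDerivAt_pw (-Q) (P + Q)
  generalize hR : (fun x : ℝ => x ^ (-Q) * (1 + x) ^ (P + Q)) = ρ at *
  have hR' : ∀ x : ℝ, x ^ (-Q) * (1 + x) ^ (P + Q) = ρ x := fun x => by rw [← hR]
  simp only [hR'] at *
  refine ⟨fun x => (-1 : ℝ) ^ k * (((-Q / x + (P + Q) / (1 + x)) * ρ x) * D k x
      + ρ x * D (k + 1) x),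
    fun x => (-1 : ℝ) ^ k * (((Q / x ^ 2 - (P + Q) / (1 + x) ^ 2) * ρ x
      + (-Q / x + (P + Q) / (1 + x)) * ((-Q / x + (P + Q) / (1 + x)) * ρ x)) * D k x
      + ((-Q / x + (P + Q) / (1 + x)) * ρ x) * D (k + 1) x
      + (((-Q / x + (P + Q) / (1 + x)) * ρ x) * D (k + 1) x
      + ρ x * D (k + 2) x)), ?_, ?_, ?_⟩
  · intro t ht
    exact ((hρ t ht).mul (key k t ht)).const_mul _
  · intro t ht
    have ht1 : (0 : ℝ) < 1 + t := by positivity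
    have hr : HasDerivAt (fun x : ℝ => -Q / x + (P + Q) / (1 + x))
        (Q / t ^ 2 - (P + Q) / (1 + t) ^ 2) t := by
      have a := (hasDerivAt_const t (-Q)).div (hasDerivAt_id' t) ht.ne'
      have b := (hasDerivAt_const t (P + Q)).div ((hasDerivAt_id' t).const_add 1) ht1.ne'
      refine (a.add b).congr_deriv ?_
      field_simp
      ring
    exact ((((hr.mul (hρ t ht)).mul (key k t ht))).add
      ((hρ t ht).mul (key (k + 1) t ht))).const_mul _
  · intro t ht
    have ht1 : (0 : ℝ) < 1 + t := by positivity
    have h := hrec t ht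
    have h' : D (k + 2) t = -((((k : ℝ) + 1) * (1 + 2 * t) - (k + Q) - (k + Q + (k - P - Q)) * t)
       * D (k + 1) t + (k + 1) * (k - (k + Q + (k - P - Q))) * D k t) / (t * (1 + t)) := by
      field_simp
      linear_combination h
    simp only [h']
    field_simp
    ring

section ops
variable {d : ℕ}

lemma xgrad_eq (g : (Fin d → ℝ) → ℝ) (x : Fin d → ℝ) : xgrad g x = fderiv ℝ g x x := by
  unfold xgrad pdx
  conv_rhs => rw [← Finset.univ_sum_single x, map_sum]
  refine Finset.sum_congr rfl fun i _ => ?_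
  have : (Pi.single i (x i) : Fin d → ℝ) = x i • Pi.single i (1 : ℝ) := by
    rw [← Pi.single_smul]; simp
  rw [Finset.univ_sum_single, this, map_smul, smul_eq_mul]

lemma pdx_const_mul (c : ℝ) (g : (Fin d → ℝ) → ℝ) (hg : Differentiable ℝ g) (i : Fin d) :
    pdx i (fun y => c * g y) = fun y => c * pdx i g y := by
  funext y
  unfold pdx
  rw [((hg y).hasFDerivAt.const_mul c).fderiv]
  simp

lemma xgrad_const_mul (c : ℝ) (g : (Fin d → ℝ) → ℝ) (hg : Differentiable ℝ g) :
    xgrad (fun y => c * g y) = fun y => c * xgrad g y := by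
  funext y
  rw [xgrad_eq, xgrad_eq, ((hg y).hasFDerivAt.const_mul c).fderiv]
  simp

lemma xgrad_add (g h : (Fin d → ℝ) → ℝ) (hg : Differentiable ℝ g) (hh : Differentiable ℝ h) :
    xgrad (fun y => g y + h y) = fun y => xgrad g y + xgrad h y := by
  funext y
  rw [xgrad_eq, xgrad_eq, xgrad_eq, ((hg y).hasFDerivAt.fun_add (hh y).hasFDerivAt).fderiv]
  simp

lemma contDiff_pdx (g : (Fin d → ℝ) → ℝ) (hg : ContDiff ℝ (⊤ : ℕ∞) g) (i : Fin d) :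
    ContDiff ℝ (⊤ : ℕ∞) (pdx i g) :=
  (hg.fderiv_right (m := (⊤ : ℕ∞)) (by simp)).clm_apply contDiff_const

lemma contDiff_xgrad (g : (Fin d → ℝ) → ℝ) (hg : ContDiff ℝ (⊤ : ℕ∞) g) :
    ContDiff ℝ (⊤ : ℕ∞) (xgrad g) := by
  have : xgrad g = fun x => fderiv ℝ g x x := funext (xgrad_eq g)
  rw [this]
  exact (hg.fderiv_right (m := (⊤ : ℕ∞)) (by simp)).clm_apply contDiff_id

lemma lapx_const_mul (c : ℝ) (g : (Fin d → ℝ) → ℝ) (hg : ContDiff ℝ (⊤ : ℕ∞) g) :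
    lapx (fun y => c * g y) = fun y => c * lapx g y := by
  funext y
  unfold lapx
  rw [Finset.mul_sum]
  refine Finset.sum_congr rfl fun i _ => ?_
  rw [pdx_const_mul c g (hg.differentiable (by simp)),
    pdx_const_mul c _ ((contDiff_pdx g hg i).differentiable (by simp))]

lemma hasDerivAt_scale (g : (Fin d → ℝ) → ℝ) (hg : Differentiable ℝ g) (m : ℕ)
    (x : Fin d → ℝ) (t s : ℝ) (ht : 0 < t) (hs : 0 < s) :
    HasDerivAt (fun s : ℝ => (s / t) ^ m * g ((t / s) • x))
      ((m * ((s / t) ^ m * g ((t / s) • x)) - (s / t) ^ m * xgrad g ((t / s) • x)) / s) s := by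
  have h1 : HasDerivAt (fun s : ℝ => (s / t) ^ m) (m * (s / t) ^ m / s) s := by
    refine (((hasDerivAt_id' s).div_const t).pow m).congr_deriv ?_
    rcases m with _ | m
    · simp
    · simp [pow_succ]; field_simp
  have h2 : HasDerivAt (fun s : ℝ => (t / s) • x) ((-(1 / s)) • (t / s) • x) s := by
    have a : HasDerivAt (fun s : ℝ => t / s) (-(1 / s) * (t / s)) s := by
      refine ((hasDerivAt_const s t).div (hasDerivAt_id' s) hs.ne').congr_deriv ?_
      field_simp
      ring
    rw [smul_smul]
    exact a.smul_const x
  have h3 := (hg ((t / s) • x)).hasFDerivAt.comp_hasDerivAt s h2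
  refine (h1.mul h3).congr_deriv ?_
  rw [xgrad_eq, map_smul, smul_eq_mul]
  simp only [Function.comp]
  field_simp
  ring

end ops

theorem stmt2 (d : ℕ) (hd : 1 ≤ d) (μ : ℝ) (hμ : -1/2 < μ) (m n : ℕ) (hmn : m ≤ n) (p : ℝ)
    (H : (Fin d → ℝ) → ℝ → ℝ)
    (hsmooth : ContDiff ℝ (⊤ : ℕ∞) (fun z : (Fin d → ℝ) × ℝ => H z.1 z.2))
    (hhom : ∀ c : ℝ, 0 < c → ∀ (x : Fin d → ℝ) (t : ℝ), 0 < t →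
      H (c • x) (c * t) = c ^ m * H x t)
    (hball : ∀ (x : Fin d → ℝ) (t : ℝ), 0 < t →
      t ^ 2 * lapx (fun y => H y t) x - xgrad (xgrad (fun y => H y t)) x
        - (2 * μ + d - 1) * xgrad (fun y => H y t) x
      = -((m : ℝ) * (m + 2 * μ + d - 1)) * H x t)
    (v : (Fin d → ℝ) → ℝ → ℝ)
    (hv : ∀ (x : Fin d → ℝ) (t : ℝ),
      v x t = finiteM (p - 2 * m - 2 * μ - d + 1) (2 * m + 2 * μ + d - 1) (n - m) t * H x t) :
    ∀ (x : Fin d → ℝ) (t : ℝ), 0 < t →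
      t * (1 + t) * deriv (deriv (v x)) t
        + 2 * (1 + t) * xgrad (fun y => deriv (v y) t) x
        + ((d : ℝ) + 2 * μ + (-p + 2 * μ + d + 1) * t) * deriv (v x) t
        + t * (1 + t) * lapx (fun y => v y t) x
        - (t ^ 2 * lapx (fun y => v y t) x - xgrad (xgrad (fun y => v y t)) x
            - (2 * μ + d - p) * xgrad (fun y => v y t) x)
      = (n : ℝ) * ((n : ℝ) - p + 2 * μ + d) * v x t := by
  intro x t ht
  obtain ⟨f1, f2, hf1, hf2, hode⟩ :=
    finiteM_ode (p - 2 * m - 2 * μ - d + 1) (2 * m + 2 * μ + d - 1) (n - m)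
  generalize hfe : finiteM (p - 2 * m - 2 * μ - d + 1) (2 * m + 2 * μ + d - 1) (n - m) = f at *
  have hgs : ContDiff ℝ (⊤ : ℕ∞) (fun y => H y t) :=
    hsmooth.comp (contDiff_id.prodMk contDiff_const)
  have hHs : ∀ y s, 0 < s → H y s = (s / t) ^ m * H ((t / s) • y) t := by
    intro y s hs
    rw [← hhom (s / t) (by positivity) _ t ht, smul_smul]
    congr 1
    · have e1 : s / t * (t / s) = 1 := by field_simp
      rw [e1, one_smul]
    · field_simp
  have hb := hball x t ht
  generalize hg : (fun y => H y t) = g at *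
  have hg' : ∀ y, H y t = g y := fun y => by rw [← hg]
  simp only [hg'] at hHs hb
  have hEs := contDiff_xgrad g hgs
  have gd : Differentiable ℝ g := hgs.differentiable (by simp)
  have Ed : Differentiable ℝ (xgrad g) := hEs.differentiable (by simp)
  have hH1 : ∀ y s, 0 < s → HasDerivAt (H y)
      ((m * ((s / t) ^ m * g ((t / s) • y)) - (s / t) ^ m * xgrad g ((t / s) • y)) / s) s := by
    intro y s hs
    refine (hasDerivAt_scale g gd m y t s ht hs).congr_of_eventuallyEq ?_
    filter_upwards [lt_mem_nhds hs] with z hz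
    exact hHs y z hz
  have hvf : ∀ y, v y = fun s => f s * H y s := fun y => funext (hv y)
  have hv1 : ∀ y s, 0 < s → deriv (v y) s = f1 s * H y s + f s *
      ((m * ((s / t) ^ m * g ((t / s) • y)) - (s / t) ^ m * xgrad g ((t / s) • y)) / s) := by
    intro y s hs
    rw [hvf y]
    exact ((hf1 s hs).mul (hH1 y s hs)).deriv
  have hv1t : ∀ y, deriv (v y) t = f1 t * g y + f t * ((m * g y - xgrad g y) / t) := by
    intro y
    rw [hv1 y t ht, hg', div_self ht.ne']
    simp
  have hv2 : deriv (deriv (v x)) t = f2 t * g x + 2 * f1 t * ((m * g x - xgrad g x) / t)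
      + f t * ((m * ((m * g x - xgrad g x) / t)
          - (m * xgrad g x - xgrad (xgrad g) x) / t) / t - (m * g x - xgrad g x) / t ^ 2) := by
    have a := hasDerivAt_scale g gd m x t t ht ht
    have b := hasDerivAt_scale (xgrad g) Ed m x t t ht ht
    have c := ((a.const_mul (m : ℝ)).sub b).div (hasDerivAt_id' t) ht.ne'
    have e := ((hf2 t ht).mul (hH1 x t ht)).add ((hf1 t ht).mul c)
    have e2 := e.congr_of_eventuallyEq (f₁ := deriv (v x)) (by
      filter_upwards [lt_mem_nhds ht] with z hz
      rw [hv1 x z hz]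
      rfl)
    rw [e2.deriv]
    simp only [Pi.sub_apply, Pi.div_apply, div_self ht.ne', one_pow, one_smul, one_mul, hg']
    field_simp
    ring
  have hvt : (fun y => v y t) = fun y => f t * g y := by
    funext y; rw [hv, hg']
  have hvd : (fun y => deriv (v y) t)
      = fun y => (f1 t + f t * m / t) * g y + (-(f t / t)) * xgrad g y := by
    funext y; rw [hv1t]; field_simp; ring
  have o := hode t ht
  rw [hvt, hvd, hv2, hv1t, hv, hg', xgrad_const_mul _ g gd, xgrad_const_mul _ _ Ed,
    lapx_const_mul _ g hgs, xgrad_add _ _ (gd.const_mul _) (Ed.const_mul _),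
    xgrad_const_mul _ g gd, xgrad_const_mul _ _ Ed]
  rw [Nat.cast_sub hmn] at o
  simp only
  field_simp
  linear_combination (t * g x) * o + (f t) * hb
end

section
/- Let d ≥ 1 be an integer, μ and q real, α = μ + (d−1)/2, m ≤ n natural numbers, and P : ℝ^d → ℝ any function. Fix x ∈ ℝ^d and t > 0. Then, as the real parameter p tends to +∞, p^m · M_{n−m}^{(p−2α−2m, q+2α+2m)}(t/p) · (t/p)^m · P(x/t) tends to (−1)^{n−m} (n−m)! · L_{n−m}^{(q+2m+2α)}(t) · t^m · P(x/t); that is, lim_{p→∞} p^m M_{k,n}^{(p,q,μ)}(x/p, t/p) = (−1)^{n−m}(n−m)! · 𝖫_{k,n}^{q,μ}(x,t), where M_{k,n}^{(p,q,μ)}(x,t) = M_{n−m}^{(p−2α−2m, q+2α+2m)}(t) t^m P(x/t) and 𝖫_{k,n}^{q,μ}(x,t) = L_{n−m}^{(q+2m+2α)}(t) t^m P(x/t). -/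
open Real Filter

/-- Generalized Laguerre polynomial `L_n^{(α)}` via the Rodrigues formula. -/
noncomputable def laguerre (α : ℝ) (n : ℕ) (x : ℝ) : ℝ :=
  x ^ (-α) * Real.exp x / (n.factorial : ℝ) *
    iteratedDeriv n (fun y : ℝ => y ^ ((n : ℝ) + α) * Real.exp (-y)) x


lemma aux_iter_rpow (r x : ℝ) (k : ℕ) :
    iteratedDeriv k (fun y : ℝ => y ^ r) x = (descPochhammer ℝ k).eval r * x ^ (r - k) := by
  rw [iteratedDeriv_eq_iterate]; exact Real.iter_deriv_rpow_const r x k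

lemma aux_finiteM (p b : ℝ) (N : ℕ) (x : ℝ) (hx : 0 < x) :
    finiteM p b N x = (-1 : ℝ) ^ N * ∑ i ∈ Finset.range (N + 1),
      (N.choose i : ℝ) * (descPochhammer ℝ i).eval ((N : ℝ) + b) *
        ((descPochhammer ℝ (N - i)).eval ((N : ℝ) - p - b) * x ^ (N - i)) * (1 + x) ^ i := by
  have h1 : (0 : ℝ) < 1 + x := by linarith
  have hL := iteratedDeriv_mul (n := N) (x := x) (f := fun y : ℝ => y ^ ((N : ℝ) + b))
    (g := fun y : ℝ => (1 + y) ^ ((N : ℝ) - p - b))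
    (Real.contDiffAt_rpow_const_of_ne hx.ne')
    (ContDiffAt.rpow_const_of_ne (by fun_prop) h1.ne')
  unfold finiteM
  change _ * iteratedDeriv N ((fun y : ℝ => y ^ ((N : ℝ) + b)) *
    fun y : ℝ => (1 + y) ^ ((N : ℝ) - p - b)) x = _
  rw [hL, mul_assoc, mul_assoc, Finset.mul_sum, Finset.mul_sum]
  congr 1
  apply Finset.sum_congr rfl
  intro i hi
  have hi' : i ≤ N := Nat.lt_succ_iff.mp (Finset.mem_range.mp hi)
  rw [aux_iter_rpow, iteratedDeriv_comp_const_add (N - i) (fun y : ℝ => y ^ ((N : ℝ) - p - b)) 1]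
  simp only [aux_iter_rpow]
  have e1 : x ^ (-b) * x ^ ((N : ℝ) + b - i) = x ^ (N - i) := by
    rw [← Real.rpow_add hx, ← Real.rpow_natCast, Nat.cast_sub hi']; congr 1; ring
  have e2 : (1 + x) ^ (p + b) * (1 + x) ^ ((N : ℝ) - p - b - (N - i : ℕ)) = (1 + x) ^ i := by
    rw [← Real.rpow_add h1, ← Real.rpow_natCast, Nat.cast_sub hi']; congr 1; ring
  rw [← e1, ← e2]; ring

lemma aux_laguerre (a : ℝ) (N : ℕ) (x : ℝ) (hx : 0 < x) :
    (N.factorial : ℝ) * laguerre a N x = ∑ i ∈ Finset.range (N + 1),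
      (N.choose i : ℝ) * (descPochhammer ℝ i).eval ((N : ℝ) + a) * (-x) ^ (N - i) * 1 := by
  have hL := iteratedDeriv_mul (n := N) (x := x) (f := fun y : ℝ => y ^ ((N : ℝ) + a))
    (g := fun y : ℝ => Real.exp (-y))
    (Real.contDiffAt_rpow_const_of_ne hx.ne') (by fun_prop)
  have hN : (N.factorial : ℝ) ≠ 0 := by positivity
  unfold laguerre
  change _ * (_ * iteratedDeriv N ((fun y : ℝ => y ^ ((N : ℝ) + a)) *
    fun y : ℝ => Real.exp (-y)) x) = _
  rw [hL, ← mul_assoc, mul_div_cancel₀ _ hN, Finset.mul_sum]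
  apply Finset.sum_congr rfl
  intro i hi
  have hi' : i ≤ N := Nat.lt_succ_iff.mp (Finset.mem_range.mp hi)
  have hE : iteratedDeriv (N - i) (fun y : ℝ => Real.exp (-y)) x
      = (-1) ^ (N - i) * Real.exp (-x) := by
    have := congrFun (iteratedDeriv_exp_const_mul (N - i) (-1)) x
    simpa only [neg_one_mul] using this
  rw [aux_iter_rpow, hE]
  have e1 : x ^ (-a) * x ^ ((N : ℝ) + a - i) = x ^ (N - i) := by
    rw [← Real.rpow_add hx, ← Real.rpow_natCast, Nat.cast_sub hi']; congr 1; ring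
  have e2 : Real.exp x * Real.exp (-x) = 1 := by rw [← Real.exp_add]; simp
  rw [neg_pow x, ← e1, ← e2]; ring

lemma aux_div (t : ℝ) : Tendsto (fun p : ℝ => t / p) atTop (nhds 0) :=
  tendsto_const_nhds.div_atTop tendsto_id

lemma aux_poch (c t : ℝ) (j : ℕ) :
    Tendsto (fun p : ℝ => (descPochhammer ℝ j).eval (c - p) * (t / p) ^ j) atTop
      (nhds ((-t) ^ j)) := by
  have h : Tendsto (fun p : ℝ => ∏ k ∈ Finset.range j, ((c - p - k) * (t / p))) atTop
      (nhds (∏ _k ∈ Finset.range j, (-t))) := by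
    apply tendsto_finsetProd
    intro k _
    have h2 : Tendsto (fun p : ℝ => (c - k) * (t / p) - t) atTop (nhds ((c - k) * 0 - t)) :=
      ((aux_div t).const_mul _).sub_const _
    rw [mul_zero, zero_sub] at h2
    refine h2.congr' ?_
    filter_upwards [eventually_gt_atTop 0] with p hp
    field_simp
    ring
  simpa [descPochhammer_eval_eq_prod_range, Finset.prod_mul_distrib, div_pow] using h

theorem stmt4 (d : ℕ) (hd : 1 ≤ d) (μ q : ℝ) (α : ℝ) (hα : α = μ + ((d : ℝ) - 1) / 2)
    (m n : ℕ) (hmn : m ≤ n) (P : (Fin d → ℝ) → ℝ) (x : Fin d → ℝ) (t : ℝ) (ht : 0 < t) :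
    Tendsto
      (fun p : ℝ =>
        p ^ m * (finiteM (p - 2 * α - 2 * m) (q + 2 * α + 2 * m) (n - m) (t / p) *
          (t / p) ^ m * P (t⁻¹ • x)))
      atTop
      (nhds ((-1 : ℝ) ^ (n - m) * ((n - m).factorial : ℝ) *
        (laguerre (q + 2 * m + 2 * α) (n - m) t * t ^ m * P (t⁻¹ • x)))) := by
  have hb : q + 2 * (m : ℝ) + 2 * α = q + 2 * α + 2 * m := by ring
  rw [hb]
  set b := q + 2 * α + 2 * (m : ℝ) with hbdef
  set N := n - m
  have key : Tendsto (fun p : ℝ => (-1 : ℝ) ^ N * ∑ i ∈ Finset.range (N + 1),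
      (N.choose i : ℝ) * (descPochhammer ℝ i).eval ((N : ℝ) + b) *
        ((descPochhammer ℝ (N - i)).eval ((N : ℝ) - q - p) * (t / p) ^ (N - i)) *
          (1 + t / p) ^ i) atTop
      (nhds ((-1 : ℝ) ^ N * ((N.factorial : ℝ) * laguerre b N t))) := by
    rw [aux_laguerre b N t ht]
    apply Tendsto.const_mul
    apply tendsto_finsetSum
    intro i _
    apply Tendsto.mul
    · exact (aux_poch _ t _).const_mul _
    · simpa using ((aux_div t).const_add 1).pow i
  have key2 := (key.mul_const (t ^ m * P (t⁻¹ • x)))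
  have e : (-1 : ℝ) ^ N * (N.factorial : ℝ) * (laguerre b N t * t ^ m * P (t⁻¹ • x))
      = (-1 : ℝ) ^ N * ((N.factorial : ℝ) * laguerre b N t) * (t ^ m * P (t⁻¹ • x)) := by ring
  rw [e]
  refine key2.congr' ?_
  filter_upwards [eventually_gt_atTop 0] with p hp
  rw [aux_finiteM _ _ _ _ (div_pos ht hp)]
  have h3 : (N : ℝ) - (p - 2 * α - 2 * m) - b = (N : ℝ) - q - p := by rw [hbdef]; ring
  have h4 : t ^ m = p ^ m * (t / p) ^ m := by
    rw [← mul_pow, mul_div_cancel₀ _ hp.ne']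
  rw [h3, h4]
  ring
end

section
/- Let d ≥ 1 be an integer, μ > −1/2, α = μ + (d−1)/2, let m ≤ n and m′ ≤ n′ be natural numbers, and let p be a real number with p > 2·max(n,n′) + 2μ + d. Let P be a ball orthogonal polynomial of degree m and P′ a ball orthogonal polynomial of degree m′ for the weight w_μ. Set b^N := b_μ^B / Γ(p−2α−1). Then b^N · ∫∫_{{(x,t)∈ℝ^d×ℝ : ‖x‖ ≤ t}} N_{n−m}^{(p−2α−2m)}(t) t^m P(x/t) · N_{n′−m′}^{(p−2α−2m′)}(t) t^{m′} P′(x/t) · (t²−‖x‖²)^{μ−1/2} t^{−p} e^{−1/t} dx dt equals ( Γ(p−2α−2m−1)/Γ(p−2α−1) ) · h_{n−m}^{(p−2α−2m)} · ( b_μ^B ∫_{B^d} P(y)P′(y)(1−‖y‖²)^{μ−1/2} dy ) if n = n′ and m = m′, and equals 0 otherwise. -/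
open MeasureTheory Real

/-- Second-class finite orthogonal polynomial `N_n^{(p)}` defined via the Rodrigues formula. -/
noncomputable def finiteN (p : ℝ) (n : ℕ) (x : ℝ) : ℝ :=
  (-1 : ℝ) ^ n * x ^ p * Real.exp (1 / x) *
    iteratedDeriv n (fun y : ℝ => y ^ (2 * (n : ℝ) - p) * Real.exp (-1 / y)) x

/-- The norm square `h_n^{(p)} = n! Γ(p−n) / ((p−2n−1) Γ(p−1))`. -/
noncomputable def hN (p : ℝ) (n : ℕ) : ℝ :=
  (n.factorial : ℝ) * Real.Gamma (p - n) / ((p - 2 * n - 1) * Real.Gamma (p - 1))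

open Set Filter Topology Polynomial

lemma w_mono_eq (a x : ℝ) (hx : 0 < x) :
    x ^ ((-1:ℝ) - 1) * (Real.exp (-(x ^ (-1:ℝ))) * (x ^ (-1:ℝ)) ^ ((-a - 1) - 1)) =
      x ^ a * Real.exp (-1 / x) := by
  have h1 : (x ^ (-1:ℝ)) ^ ((-a - 1) - 1) = x ^ (a + 2) := by
    rw [← Real.rpow_mul hx.le]; congr 1; ring
  rw [h1, mul_left_comm, ← Real.rpow_add hx, mul_comm, Real.rpow_neg_one]
  congr 2
  · ring
  · rw [neg_div, one_div]

lemma w_mono_integrable (a : ℝ) (ha : a < -1) :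
    IntegrableOn (fun x : ℝ => x ^ a * Real.exp (-1 / x)) (Ioi 0) := by
  have h := Real.GammaIntegral_convergent (s := -a - 1) (by linarith)
  rw [← integrableOn_Ioi_comp_rpow_iff' _ (p := -1) (by norm_num)] at h
  refine h.congr_fun (fun x hx => ?_) measurableSet_Ioi
  exact w_mono_eq a x hx

lemma w_mono_integral (a : ℝ) (ha : a < -1) :
    ∫ x in Ioi (0:ℝ), x ^ a * Real.exp (-1 / x) = Real.Gamma (-a - 1) := by
  rw [Real.Gamma_eq_integral (by linarith), ← integral_comp_rpow_Ioi (fun x => Real.exp (-x) * x ^ ((-a - 1) - 1)) (p := -1) (by norm_num)]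
  refine setIntegral_congr_fun measurableSet_Ioi (fun x hx => ?_)
  simp only [abs_neg, abs_one, one_mul, smul_eq_mul]
  exact (w_mono_eq a x hx).symm

lemma w_mono_zero (a : ℝ) :
    Tendsto (fun x : ℝ => x ^ a * Real.exp (-1 / x)) (𝓝[>] 0) (𝓝 0) := by
  have h := (tendsto_rpow_mul_exp_neg_mul_atTop_nhds_zero (-a) 1 one_pos).comp
    tendsto_inv_nhdsGT_zero
  refine h.congr' ?_
  filter_upwards [self_mem_nhdsWithin] with x hx
  have hx : (0:ℝ) < x := hx
  simp only [Function.comp]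
  rw [Real.inv_rpow hx.le, Real.rpow_neg hx.le, inv_inv]
  congr 2

lemma w_mono_top (a : ℝ) (ha : a < 0) :
    Tendsto (fun x : ℝ => x ^ a * Real.exp (-1 / x)) atTop (𝓝 0) := by
  have h1 : Tendsto (fun x : ℝ => x ^ a) atTop (𝓝 0) := by
    have := tendsto_rpow_neg_atTop (y := -a) (by linarith)
    simpa using this
  have h2 : Tendsto (fun x : ℝ => Real.exp (-1 / x)) atTop (𝓝 (Real.exp 0)) :=
    (Real.continuous_exp.tendsto 0).comp (tendsto_const_nhds.div_atTop tendsto_id)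
  simpa using h1.mul h2

lemma w_poly_eq (A : ℝ[X]) (a x : ℝ) (hx : 0 < x) :
    x ^ a * Real.exp (-1 / x) * A.eval x =
      ∑ i ∈ Finset.range (A.natDegree + 1), A.coeff i * (x ^ (a + i) * Real.exp (-1 / x)) := by
  rw [Polynomial.eval_eq_sum_range, Finset.mul_sum]
  refine Finset.sum_congr rfl fun i _ => ?_
  rw [Real.rpow_add hx, Real.rpow_natCast]; ring

lemma w_poly_integrable (A : ℝ[X]) (a : ℝ) (N : ℕ) (hA : A.natDegree ≤ N) (ha : a + N < -1) :
    IntegrableOn (fun x : ℝ => x ^ a * Real.exp (-1 / x) * A.eval x) (Ioi 0) := by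
  have : IntegrableOn (fun x : ℝ => ∑ i ∈ Finset.range (A.natDegree + 1),
      A.coeff i * (x ^ (a + i) * Real.exp (-1 / x))) (Ioi 0) := by
    refine integrable_finsetSum _ fun i hi => ?_
    refine (w_mono_integrable _ ?_).const_mul _
    have : i ≤ N := by have := Finset.mem_range.1 hi; omega
    have : (i:ℝ) ≤ N := by exact_mod_cast this
    linarith
  exact this.congr_fun (fun x hx => (w_poly_eq A a x hx).symm) measurableSet_Ioi

lemma w_poly_zero (A : ℝ[X]) (a : ℝ) :
    Tendsto (fun x : ℝ => x ^ a * Real.exp (-1 / x) * A.eval x) (𝓝[>] 0) (𝓝 0) := by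
  have h1 : Tendsto (fun x : ℝ => A.eval x) (𝓝[>] 0) (𝓝 (A.eval 0)) :=
    (A.continuous.tendsto 0).mono_left nhdsWithin_le_nhds
  simpa using (w_mono_zero a).mul h1

lemma w_poly_top (A : ℝ[X]) (a : ℝ) (N : ℕ) (hA : A.natDegree ≤ N) (ha : a + N < 0) :
    Tendsto (fun x : ℝ => x ^ a * Real.exp (-1 / x) * A.eval x) atTop (𝓝 0) := by
  have : Tendsto (fun x : ℝ => ∑ i ∈ Finset.range (A.natDegree + 1),
      A.coeff i * (x ^ (a + i) * Real.exp (-1 / x))) atTop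
      (𝓝 (∑ i ∈ Finset.range (A.natDegree + 1), A.coeff i * 0)) := by
    refine tendsto_finsetSum _ fun i hi => ?_
    refine (w_mono_top _ ?_).const_mul _
    have : i ≤ N := by have := Finset.mem_range.1 hi; omega
    have : (i:ℝ) ≤ N := by exact_mod_cast this
    linarith
  simp only [mul_zero, Finset.sum_const_zero] at this
  refine this.congr' ?_
  filter_upwards [eventually_gt_atTop 0] with x hx
  exact (w_poly_eq A a x hx).symm

/-- The polynomial factor of the `j`-th derivative of `x ^ s * exp (-1/x)`. -/
noncomputable def rPoly (s : ℝ) : ℕ → ℝ[X]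
  | 0 => 1
  | j + 1 => C (s - 2 * j) * (X * rPoly s j) + rPoly s j + X * (X * derivative (rPoly s j))

lemma rPoly_natDegree (s : ℝ) (j : ℕ) : (rPoly s j).natDegree ≤ j := by
  induction j with
  | zero => simp [rPoly]
  | succ j ih =>
    have hd : (derivative (rPoly s j)).natDegree ≤ j - 1 :=
      (natDegree_derivative_le _).trans (by omega)
    have h1 : (X * rPoly s j).natDegree ≤ j + 1 := natDegree_mul_le.trans (by
      have := natDegree_X_le (R := ℝ); omega)
    have h2 : (X * (X * derivative (rPoly s j))).natDegree ≤ j + 1 := by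
      by_cases h0 : j = 0
      · subst h0
        simp [rPoly]
      · refine natDegree_mul_le.trans ?_
        have h3 := natDegree_mul_le (p := (X : ℝ[X])) (q := derivative (rPoly s j))
        have := natDegree_X_le (R := ℝ)
        omega
    rw [rPoly]
    refine natDegree_add_le_of_degree_le (natDegree_add_le_of_degree_le ?_ (by omega)) h2
    exact (natDegree_C_mul_le _ _).trans h1

lemma rPoly_coeff_succ (s : ℝ) (j : ℕ) :
    (rPoly s (j+1)).coeff (j+1) = (s - j) * (rPoly s j).coeff j := by
  have h0 : (rPoly s j).coeff (j+1) = 0 :=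
    coeff_eq_zero_of_natDegree_lt (by have := rPoly_natDegree s j; omega)
  rw [rPoly]
  simp only [coeff_add, coeff_C_mul, coeff_X_mul, h0]
  cases j with
  | zero => simp
  | succ i =>
    rw [coeff_X_mul, coeff_derivative]; push_cast; ring

lemma rPoly_hasDerivAt (s : ℝ) (j : ℕ) (x : ℝ) (hx : 0 < x) :
    HasDerivAt (fun y : ℝ => y ^ (s - 2 * j) * Real.exp (-1 / y) * (rPoly s j).eval y)
      (x ^ (s - 2 * ((j + 1 : ℕ) : ℝ)) * Real.exp (-1 / x) * (rPoly s (j+1)).eval x) x := by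
  have h1 : HasDerivAt (fun y : ℝ => y ^ (s - 2 * j)) ((s - 2 * j) * x ^ (s - 2 * j - 1)) x :=
    Real.hasDerivAt_rpow_const (Or.inl hx.ne')
  have h2 : HasDerivAt (fun y : ℝ => Real.exp (-1 / y)) (Real.exp (-1 / x) * (1 / x ^ 2)) x := by
    have : HasDerivAt (fun y : ℝ => -1 / y) (1 / x ^ 2) x := by
      have := (hasDerivAt_inv hx.ne').const_mul (-1)
      have hf : (fun y : ℝ => -1 / y) = fun y : ℝ => -1 * y⁻¹ := by
        funext y; exact div_eq_mul_inv _ _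
      rw [hf]
      exact this.congr_deriv (by ring)
    exact this.exp
  have h3 := (h1.mul h2).mul ((rPoly s j).hasDerivAt x)
  refine HasDerivAt.congr_deriv h3 ?_
  have e1 : x ^ (s - 2 * (j:ℝ)) = x ^ (s - 2 * ((j + 1 : ℕ) : ℝ)) * x ^ 2 := by
    rw [← Real.rpow_natCast, ← Real.rpow_add hx]; congr 1; push_cast; ring
  have e2 : x ^ (s - 2 * (j:ℝ) - 1) = x ^ (s - 2 * ((j + 1 : ℕ) : ℝ)) * x := by
    rw [← Real.rpow_add_one hx.ne']; congr 1; push_cast; ring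
  simp only [Pi.mul_apply]
  rw [e1, e2, rPoly]
  simp only [eval_add, eval_mul, eval_C, eval_X]
  field_simp

lemma rPoly_iteratedDeriv (s : ℝ) (j : ℕ) (x : ℝ) (hx : 0 < x) :
    iteratedDeriv j (fun y : ℝ => y ^ s * Real.exp (-1 / y)) x =
      x ^ (s - 2 * (j:ℝ)) * Real.exp (-1 / x) * (rPoly s j).eval x := by
  induction j generalizing x with
  | zero => simp [rPoly]
  | succ j ih =>
    rw [iteratedDeriv_succ, ← (rPoly_hasDerivAt s j x hx).deriv]
    refine Filter.EventuallyEq.deriv_eq ?_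
    filter_upwards [Ioi_mem_nhds hx] with y hy
    exact ih y hy

lemma finiteN_eq (q : ℝ) (n : ℕ) (x : ℝ) (hx : 0 < x) :
    finiteN q n x = (-1) ^ n * (rPoly (2 * n - q) n).eval x := by
  rw [finiteN, rPoly_iteratedDeriv _ _ _ hx]
  have e1 : x ^ (2 * (n:ℝ) - q - 2 * n) = (x ^ q)⁻¹ := by
    rw [← Real.rpow_neg hx.le]; congr 1; ring
  have e2 : Real.exp (-1 / x) = (Real.exp (1 / x))⁻¹ := by
    rw [← Real.exp_neg]; congr 1; ring
  rw [e1, e2]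
  have := (Real.rpow_pos_of_pos hx q).ne'
  have := (Real.exp_pos (1/x)).ne'
  field_simp

lemma by_parts (s : ℝ) (hs : s < -1) (j : ℕ) (R : ℝ[X]) (hR : R.natDegree ≤ j) :
    ∫ x in Ioi (0:ℝ), R.eval x * (x ^ (s - 2 * (j:ℝ)) * Real.exp (-1 / x) * (rPoly s j).eval x) =
      (-1) ^ j * j.factorial * R.coeff j * Real.Gamma (-s - 1) := by
  induction j generalizing R with
  | zero =>
    rw [natDegree_eq_zero_iff_degree_le_zero.1 (Nat.le_zero.1 hR) |> eq_C_of_degree_le_zero]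
    simp [rPoly, integral_const_mul, w_mono_integral s hs]
  | succ j ih =>
    have hd : (derivative R).natDegree ≤ j := (natDegree_derivative_le _).trans (by omega)
    have hr := rPoly_natDegree s j
    have hr' := rPoly_natDegree s (j+1)
    have key := integral_Ioi_mul_deriv_eq_deriv_mul (a := 0) (a' := 0) (b' := 0)
      (u := fun x => R.eval x) (u' := fun x => (derivative R).eval x)
      (v := fun y : ℝ => y ^ (s - 2 * j) * Real.exp (-1 / y) * (rPoly s j).eval y)
      (v' := fun x : ℝ => x ^ (s - 2 * ((j + 1 : ℕ) : ℝ)) * Real.exp (-1 / x) *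
        (rPoly s (j+1)).eval x)
      (fun x _ => R.hasDerivAt x) (fun x hx => rPoly_hasDerivAt s j x hx)
      (by
        have := w_poly_integrable (R * rPoly s (j+1)) (s - 2 * ((j + 1 : ℕ) : ℝ)) (2 * (j+1))
          (natDegree_mul_le.trans (by omega)) (by push_cast; linarith)
        convert this using 1
        ext x; simp only [Pi.mul_apply, eval_mul]; ring)
      (by
        have := w_poly_integrable (derivative R * rPoly s j) (s - 2 * j) (2 * j)
          (natDegree_mul_le.trans (by omega)) (by push_cast; linarith)
        convert this using 1
        ext x; simp only [Pi.mul_apply, eval_mul]; ring)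
      (by
        have := w_poly_zero (R * rPoly s j) (s - 2 * j)
        convert this using 1
        ext x; simp only [Pi.mul_apply, eval_mul]; ring)
      (by
        have := w_poly_top (R * rPoly s j) (s - 2 * j) (2 * j + 1)
          (natDegree_mul_le.trans (by omega)) (by push_cast; linarith)
        convert this using 1
        ext x; simp only [Pi.mul_apply, eval_mul]; ring)
    rw [key, ih _ hd, coeff_derivative, Nat.factorial_succ]
    push_cast; ring

lemma rPoly_coeff (s : ℝ) (n j : ℕ) (hj : j ≤ n) (q : ℝ) (hq : 2 * (n:ℝ) + 1 < q)
    (hs : s = 2 * n - q) :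
    (rPoly s j).coeff j * Real.Gamma (-s) = (-1) ^ j * Real.Gamma (-s + j) := by
  induction j with
  | zero => simp [rPoly]
  | succ j ih =>
    have h := ih (by omega)
    have hne : -s + j ≠ 0 := by
      have : (0:ℝ) ≤ j := j.cast_nonneg
      have : 0 < -s + j := by rw [hs]; linarith
      exact this.ne'
    rw [rPoly_coeff_succ, mul_assoc, h]
    push_cast
    rw [← add_assoc, Real.Gamma_add_one hne]; ring

/-- One-dimensional orthogonality, ordered degrees. -/
lemma N_ortho_aux (q : ℝ) (k k' : ℕ) (hk : k' ≤ k) (hq : 2 * (k:ℝ) + 1 < q) :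
    ∫ x in Ioi (0:ℝ), finiteN q k x * finiteN q k' x * (x ^ (-q) * Real.exp (-1 / x)) =
      if k = k' then Real.Gamma (q - 1) * hN q k else 0 := by
  have h := by_parts (2 * k - q) (by linarith) k (C ((-1)^(k+k')) * rPoly (2 * k' - q) k')
    ((natDegree_C_mul_le _ _).trans ((rPoly_natDegree _ _).trans hk))
  have e : ∫ x in Ioi (0:ℝ), finiteN q k x * finiteN q k' x * (x ^ (-q) * Real.exp (-1 / x)) =
      ∫ x in Ioi (0:ℝ), (C ((-1)^(k+k')) * rPoly (2 * k' - q) k').eval x *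
        (x ^ (2 * (k:ℝ) - q - 2 * (k:ℝ)) * Real.exp (-1 / x) * (rPoly (2 * k - q) k).eval x) := by
    refine setIntegral_congr_fun measurableSet_Ioi (fun x hx => ?_)
    simp only [eval_mul, eval_C]
    rw [finiteN_eq q k x hx, finiteN_eq q k' x hx, show 2 * (k:ℝ) - q - 2 * (k:ℝ) = -q by ring]
    ring
  rw [e, h, coeff_C_mul]
  split_ifs with hkk
  · subst hkk
    have hc := rPoly_coeff (2 * k - q) k k le_rfl q hq rfl
    have hkn : (0:ℝ) ≤ k := k.cast_nonneg
    have g1 : Real.Gamma (-(2 * k - q)) = (q - 2 * k - 1) * Real.Gamma (-(2 * k - q) - 1) := by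
      rw [show q - 2 * k - 1 = -(2 * (k:ℝ) - q) - 1 by ring, ← Real.Gamma_add_one (by linarith)]
      congr 1; ring
    rw [g1, show -(2 * (k:ℝ) - q) + k = q - k by ring] at hc
    have n1 : (q - 2 * k - 1) ≠ 0 := by linarith
    have n2 : Real.Gamma (q - 1) ≠ 0 := (Real.Gamma_pos_of_pos (by linarith)).ne'
    rw [hN]
    have p1 : ((-1:ℝ)^k)*((-1)^k) = 1 := by rw [← mul_pow]; simp
    rw [pow_add, p1]
    field_simp
    rw [show (-1:ℝ) ^ k * (rPoly (2 * k - q) k).coeff k *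
      Real.Gamma (-(2 * k - q) - 1) * (q - 2 * k - 1) = (-1) ^ k * ((rPoly (2 * k - q) k).coeff k *
      ((q - 2 * k - 1) * Real.Gamma (-(2 * k - q) - 1))) by ring, hc, ← mul_assoc, p1, one_mul]
  · rw [coeff_eq_zero_of_natDegree_lt (lt_of_le_of_lt (rPoly_natDegree _ _) (by omega))]
    simp

lemma N_ortho (q : ℝ) (k k' : ℕ) (hq : 2 * ((max k k' : ℕ):ℝ) + 1 < q) :
    ∫ x in Ioi (0:ℝ), finiteN q k x * finiteN q k' x * (x ^ (-q) * Real.exp (-1 / x)) =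
      if k = k' then Real.Gamma (q - 1) * hN q k else 0 := by
  rcases le_total k' k with h | h
  · rw [max_eq_left h] at hq
    exact N_ortho_aux q k k' h hq
  · rw [max_eq_right h] at hq
    have := N_ortho_aux q k' k h hq
    simp only [mul_comm (finiteN q k' _)] at this
    rw [this]
    by_cases hh : k = k'
    · subst hh; simp
    · rw [if_neg hh, if_neg (Ne.symm hh)]

lemma cone_map (d : ℕ) :
    Measure.map (fun z : EuclideanSpace ℝ (Fin d) × ℝ => (z.2 • z.1, z.2))
      ((volume : Measure (EuclideanSpace ℝ (Fin d))).prod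
        ((volume.restrict (Ioi (0:ℝ))).withDensity (fun t => ENNReal.ofReal (t ^ d)))) =
      (volume : Measure (EuclideanSpace ℝ (Fin d))).prod (volume.restrict (Ioi (0:ℝ))) := by
  have hg : Measurable (fun z : EuclideanSpace ℝ (Fin d) × ℝ => (z.2 • z.1, z.2)) := by fun_prop
  ext s hs
  rw [Measure.map_apply hg hs, Measure.prod_apply_symm (hg hs), Measure.prod_apply_symm hs,
    lintegral_withDensity_eq_lintegral_mul₀ (by fun_prop)
      (measurable_measure_prodMk_right (hg hs)).aemeasurable]
  refine setLIntegral_congr_fun measurableSet_Ioi (fun t ht => ?_)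
  have ht : (0:ℝ) < t := ht
  have h := Measure.addHaar_preimage_smul (volume : Measure (EuclideanSpace ℝ (Fin d))) ht.ne'
    ((fun x => (x, t)) ⁻¹' s)
  rw [finrank_euclideanSpace_fin, abs_of_pos (by positivity)] at h
  have e : (fun x => (x, t)) ⁻¹' ((fun z : EuclideanSpace ℝ (Fin d) × ℝ => (z.2 • z.1, z.2)) ⁻¹' s)
    = (fun x : EuclideanSpace ℝ (Fin d) => t • x) ⁻¹' ((fun x => (x, t)) ⁻¹' s) := rfl
  simp only [Pi.mul_apply]
  rw [e, h, ← mul_assoc, ← ENNReal.ofReal_mul (by positivity), mul_inv_cancel₀ (by positivity)]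
  simp

lemma cone_integral (d : ℕ) (A : ℝ → ℝ) (B : EuclideanSpace ℝ (Fin d) → ℝ)
    (hA : Measurable A) (hB : Measurable B) :
    ∫ z in {z : EuclideanSpace ℝ (Fin d) × ℝ | ‖z.1‖ ≤ z.2}, A z.2 * B (z.2⁻¹ • z.1) =
      (∫ t in Ioi (0:ℝ), t ^ d * A t) * ∫ y in Metric.closedBall 0 1, B y := by
  set S := {z : EuclideanSpace ℝ (Fin d) × ℝ | ‖z.1‖ ≤ z.2} with hS
  have hSm : MeasurableSet S := measurableSet_le (by fun_prop) (by fun_prop)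
  have hg : Measurable (fun z : EuclideanSpace ℝ (Fin d) × ℝ => (z.2 • z.1, z.2)) := by fun_prop
  set F : EuclideanSpace ℝ (Fin d) × ℝ → ℝ :=
    S.indicator (fun z => A z.2 * B (z.2⁻¹ • z.1)) with hF
  have hFm : Measurable F := by
    refine Measurable.indicator ?_ hSm
    fun_prop
  have hr : (volume : Measure (EuclideanSpace ℝ (Fin d) × ℝ)).restrict (univ ×ˢ Ioi 0) =
      (volume : Measure (EuclideanSpace ℝ (Fin d))).prod (volume.restrict (Ioi (0:ℝ))) := by
    rw [Measure.volume_eq_prod, ← Measure.prod_restrict, Measure.restrict_univ]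
  have hnull : (volume : Measure (EuclideanSpace ℝ (Fin d) × ℝ)) (univ ×ˢ {(0:ℝ)}) = 0 := by
    rw [Measure.volume_eq_prod, Measure.prod_prod]; simp
  have h1 : ∫ z in S, A z.2 * B (z.2⁻¹ • z.1) = ∫ z in univ ×ˢ Ioi 0, F z := by
    rw [← integral_indicator hSm, ← integral_indicator (MeasurableSet.univ.prod measurableSet_Ioi)]
    refine integral_congr_ae ?_
    have : ∀ᵐ z : EuclideanSpace ℝ (Fin d) × ℝ, z ∉ (univ ×ˢ {(0:ℝ)} :
      Set (EuclideanSpace ℝ (Fin d) × ℝ)) := measure_eq_zero_iff_ae_notMem.1 hnull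
    filter_upwards [this] with z hz
    simp only [mem_prod, mem_univ, true_and, mem_singleton_iff] at hz
    by_cases hzS : z ∈ S
    · have : 0 < z.2 := lt_of_le_of_ne ((norm_nonneg _).trans hzS) (Ne.symm hz)
      rw [indicator_of_mem (s := univ ×ˢ Ioi 0) (by simp [this])]
    · rw [indicator_of_notMem hzS]
      symm
      by_cases hz2 : z ∈ (univ ×ˢ Ioi (0:ℝ) : Set (EuclideanSpace ℝ (Fin d) × ℝ))
      · rw [indicator_of_mem hz2, hF, indicator_of_notMem hzS]
      · rw [indicator_of_notMem hz2]
  rw [h1, hr, ← cone_map d, integral_map hg.aemeasurable hFm.aestronglyMeasurable]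
  have h2 : ∀ᵐ z ∂((volume : Measure (EuclideanSpace ℝ (Fin d))).prod
        ((volume.restrict (Ioi (0:ℝ))).withDensity (fun t => ENNReal.ofReal (t ^ d)))),
      F (z.2 • z.1, z.2) = (Metric.closedBall 0 1).indicator B z.1 * A z.2 := by
    have h3 : ∀ᵐ t ∂((volume.restrict (Ioi (0:ℝ))).withDensity (fun t => ENNReal.ofReal (t ^ d))),
        0 < t := (withDensity_absolutelyContinuous _ _).ae_le
          (ae_restrict_mem measurableSet_Ioi)
    have h4 := Measure.quasiMeasurePreserving_snd
      (μ := (volume : Measure (EuclideanSpace ℝ (Fin d)))) |>.ae h3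
    filter_upwards [h4] with z hz
    have hiff : (z.2 • z.1, z.2) ∈ S ↔ z.1 ∈ Metric.closedBall 0 1 := by
      simp only [hS, mem_ofPred_eq, norm_smul, Real.norm_eq_abs, abs_of_pos hz,
        mem_closedBall_zero_iff]
      exact mul_le_iff_le_one_right hz
    by_cases hb : z.1 ∈ Metric.closedBall 0 1
    · rw [hF, indicator_of_mem (hiff.2 hb), indicator_of_mem hb]
      simp only [smul_smul, inv_mul_cancel₀ hz.ne', one_smul]
      ring
    · rw [hF, indicator_of_notMem (fun h => hb (hiff.1 h)), indicator_of_notMem hb, zero_mul]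
  rw [integral_congr_ae h2, integral_prod_mul, integral_indicator Metric.isClosed_closedBall.measurableSet,
    integral_withDensity_eq_integral_toReal_smul (by fun_prop) (by simp), mul_comm]
  congr 1
  refine setIntegral_congr_fun measurableSet_Ioi (fun t ht => ?_)
  have ht : (0:ℝ) < t := ht
  simp only [smul_eq_mul]
  rw [ENNReal.toReal_ofReal (by positivity)]

theorem stmt8 (d : ℕ) (hd : 1 ≤ d) (μ : ℝ) (hμ : -1/2 < μ)
    (α : ℝ) (hα : α = μ + ((d : ℝ) - 1) / 2)
    (m n m' n' : ℕ) (hmn : m ≤ n) (hmn' : m' ≤ n') (p : ℝ)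
    (hp : 2 * ((max n n' : ℕ) : ℝ) + 2 * μ + d < p)
    (P P' : EuclideanSpace ℝ (Fin d) → ℝ)
    (hP : IsBallOrtho d μ m P) (hP' : IsBallOrtho d μ m' P') :
    (ballB d μ / Real.Gamma (p - 2 * α - 1)) *
      ∫ z in {z : EuclideanSpace ℝ (Fin d) × ℝ | ‖z.1‖ ≤ z.2},
        (finiteN (p - 2 * α - 2 * m) (n - m) z.2 * z.2 ^ m * P (z.2⁻¹ • z.1)) *
        (finiteN (p - 2 * α - 2 * m') (n' - m') z.2 * z.2 ^ m' * P' (z.2⁻¹ • z.1)) *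
        ((z.2 ^ 2 - ‖z.1‖ ^ 2) ^ (μ - 1/2) * z.2 ^ (-p) * Real.exp (-1 / z.2)) =
    if n = n' ∧ m = m' then
      (Real.Gamma (p - 2 * α - 2 * m - 1) / Real.Gamma (p - 2 * α - 1)) *
        hN (p - 2 * α - 2 * m) (n - m) *
        (ballB d μ *
          ∫ y in Metric.closedBall (0 : EuclideanSpace ℝ (Fin d)) 1,
            P y * P' y * (1 - ‖y‖ ^ 2) ^ (μ - 1/2))
    else 0 := by
  obtain ⟨Q, hQd, hQ, hQo⟩ := hP
  obtain ⟨Q', hQd', hQ', hQo'⟩ := hP'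
  have hPm : Measurable P := by
    have : P = fun y => MvPolynomial.eval (fun i => y i) Q := funext hQ
    rw [this]
    exact ((MvPolynomial.continuous_eval Q).comp (by fun_prop)).measurable
  have hPm' : Measurable P' := by
    have : P' = fun y => MvPolynomial.eval (fun i => y i) Q' := funext hQ'
    rw [this]
    exact ((MvPolynomial.continuous_eval Q').comp (by fun_prop)).measurable
  set R := rPoly (2 * ((n - m : ℕ):ℝ) - (p - 2 * α - 2 * m)) (n - m) with hR
  set R' := rPoly (2 * ((n' - m' : ℕ):ℝ) - (p - 2 * α - 2 * m')) (n' - m') with hR'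
  set A : ℝ → ℝ := fun t => ((-1) ^ (n - m) * R.eval t) * ((-1) ^ (n' - m') * R'.eval t) *
    (t ^ (m + m') * t ^ (2 * μ - 1) * t ^ (-p) * Real.exp (-1 / t)) with hA
  set B : EuclideanSpace ℝ (Fin d) → ℝ :=
    fun y => P y * P' y * (1 - ‖y‖ ^ 2) ^ (μ - 1/2) with hB
  have hAm : Measurable A := by
    have h1 : Measurable (fun t => R.eval t) := R.continuous.measurable
    have h2 : Measurable (fun t => R'.eval t) := R'.continuous.measurable
    rw [hA]; fun_prop
  have hBm : Measurable B := by rw [hB]; fun_prop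
  have hN1 : ∀ t : ℝ, 0 < t → finiteN (p - 2 * α - 2 * m) (n - m) t = (-1) ^ (n - m) * R.eval t :=
    fun t ht => finiteN_eq _ _ t ht
  have hN2 : ∀ t : ℝ, 0 < t →
      finiteN (p - 2 * α - 2 * m') (n' - m') t = (-1) ^ (n' - m') * R'.eval t :=
    fun t ht => finiteN_eq _ _ t ht
  have hSm : MeasurableSet {z : EuclideanSpace ℝ (Fin d) × ℝ | ‖z.1‖ ≤ z.2} :=
    measurableSet_le (by fun_prop) (by fun_prop)
  have hnull : (volume : Measure (EuclideanSpace ℝ (Fin d) × ℝ)) (univ ×ˢ {(0:ℝ)}) = 0 := by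
    rw [Measure.volume_eq_prod, Measure.prod_prod]; simp
  have hae : ∀ᵐ z : EuclideanSpace ℝ (Fin d) × ℝ, z ∉ (univ ×ˢ {(0:ℝ)} :
      Set (EuclideanSpace ℝ (Fin d) × ℝ)) := measure_eq_zero_iff_ae_notMem.1 hnull
  have e1 : ∫ z in {z : EuclideanSpace ℝ (Fin d) × ℝ | ‖z.1‖ ≤ z.2},
        (finiteN (p - 2 * α - 2 * m) (n - m) z.2 * z.2 ^ m * P (z.2⁻¹ • z.1)) *
        (finiteN (p - 2 * α - 2 * m') (n' - m') z.2 * z.2 ^ m' * P' (z.2⁻¹ • z.1)) *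
        ((z.2 ^ 2 - ‖z.1‖ ^ 2) ^ (μ - 1/2) * z.2 ^ (-p) * Real.exp (-1 / z.2)) =
      (∫ t in Ioi (0:ℝ), t ^ d * A t) * ∫ y in Metric.closedBall 0 1, B y := by
    rw [← cone_integral d A B hAm hBm]
    refine setIntegral_congr_ae hSm ?_
    filter_upwards [hae] with z hz hzS
    simp only [mem_prod, mem_univ, true_and, mem_singleton_iff] at hz
    have hzS : ‖z.1‖ ≤ z.2 := hzS
    have ht : 0 < z.2 := lt_of_le_of_ne ((norm_nonneg _).trans hzS) (Ne.symm hz)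
    have hw : (z.2 ^ 2 - ‖z.1‖ ^ 2) ^ (μ - 1/2) =
        z.2 ^ (2 * μ - 1) * (1 - ‖z.2⁻¹ • z.1‖ ^ 2) ^ (μ - 1/2) := by
      have hn : ‖z.2⁻¹ • z.1‖ = z.2⁻¹ * ‖z.1‖ := by
        rw [norm_smul, Real.norm_eq_abs, abs_of_pos (inv_pos.2 ht)]
      have hle : z.2⁻¹ * ‖z.1‖ ≤ 1 := by
        rw [inv_mul_le_iff₀ ht]; linarith
      have h0 : 0 ≤ z.2⁻¹ * ‖z.1‖ := by positivity
      have : z.2 ^ (2 * μ - 1) = (z.2 ^ 2) ^ (μ - 1/2) := by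
        rw [← Real.rpow_natCast, ← Real.rpow_mul ht.le]; congr 1; push_cast; ring
      rw [this, hn, ← Real.mul_rpow (by positivity) (by nlinarith)]
      congr 1
      field_simp
    rw [hN1 _ ht, hN2 _ ht, hw]
    simp only [hA, hB]
    ring
  rw [e1]
  by_cases hmm : m = m'
  · subst hmm
    have hmax : ((max (n - m) (n' - m) : ℕ) : ℝ) = ((max n n' : ℕ) : ℝ) - m := by
      rw [show max (n - m) (n' - m) = max n n' - m by omega, Nat.cast_sub (by omega)]
    have h1 := N_ortho (p - 2 * α - 2 * m) (n - m) (n' - m) (by rw [hmax, hα]; linarith)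
    have e2 : ∫ t in Ioi (0:ℝ), t ^ d * A t = ∫ x in Ioi (0:ℝ),
        finiteN (p - 2 * α - 2 * m) (n - m) x * finiteN (p - 2 * α - 2 * m) (n' - m) x *
        (x ^ (-(p - 2 * α - 2 * m)) * Real.exp (-1 / x)) := by
      refine setIntegral_congr_fun measurableSet_Ioi (fun t ht => ?_)
      have ht : (0:ℝ) < t := ht
      simp only [hA]
      rw [hN1 t ht, hN2 t ht]
      have : t ^ (-(p - 2 * α - 2 * m)) = t ^ d * (t ^ (m + m) * t ^ (2 * μ - 1) * t ^ (-p)) := by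
        rw [← Real.rpow_natCast t d, ← Real.rpow_natCast t (m + m), ← Real.rpow_add ht,
          ← Real.rpow_add ht, ← Real.rpow_add ht, hα]
        congr 1; push_cast; ring
      rw [this]; ring
    rw [e2, h1]
    by_cases hnn : n = n'
    · subst hnn
      simp only [if_true, and_self]
      ring
    · rw [if_neg (by omega), if_neg (by tauto)]
      simp
  · rw [if_neg (by tauto)]
    have : ∫ y in Metric.closedBall 0 1, B y = 0 := by
      rcases lt_or_gt_of_ne hmm with h | h
      · rw [← hQo' Q (by omega)]
        congr 1; ext y
        simp only [hB]
        rw [hQ y]; ring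
      · rw [← hQo Q' (by omega)]
        congr 1; ext y
        simp only [hB]
        rw [hQ' y]
    rw [this]; simp
end

section
/- Let d ≥ 1 be an integer, μ real, α = μ + (d−1)/2, m ≤ n natural numbers, P : ℝ^d → ℝ any function, and p a real number with p − 2μ − m − n − d ≠ 0 and p − 2μ − 2n − d + 1 ≠ 0. Define N_{k,n}^{(μ,p)}(x,t) = N_{n−m}^{(p−2α−2m)}(t) t^m P(x/t) for t > 0 (the same m and P for every n). Then for all x ∈ ℝ^d and t > 0: N_{k,n+1}^{(μ,p)}(x,t) = { [(p−2μ−2n−d−1)(p−2μ−2n−d)/(p−2μ−m−n−d)] t − (p−2μ−2m−d+1)(p−2μ−2n−d)/((p−2μ−m−n−d)(p−2μ−2n−d+1)) } · N_{k,n}^{(μ,p)}(x,t) − [ (n−m)(p−2μ−2n−d−1)/((p−2μ−m−n−d)(p−2μ−2n−d+1)) ] · N_{k,n−1}^{(μ,p)}(x,t), where for n = m the last term is interpreted as zero (its coefficient contains the factor n−m). -/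
open Real

/-- `j`-th derivative at `x` of `y ^ a * exp (-1 / y)`. -/
noncomputable def auxG (x : ℝ) (j : ℕ) (a : ℝ) : ℝ :=
  iteratedDeriv j (fun y : ℝ => y ^ a * Real.exp (-1 / y)) x

lemma auxF_contDiffAt {x : ℝ} (hx : 0 < x) (a : ℝ) (j : ℕ) :
    ContDiffAt ℝ j (fun y : ℝ => y ^ a * Real.exp (-1 / y)) x := by
  refine ContDiffAt.mul (Real.contDiffAt_rpow_const_of_ne hx.ne') ?_
  exact (contDiffAt_const.div contDiffAt_id hx.ne').exp

lemma auxF_deriv {y : ℝ} (hy : 0 < y) (a : ℝ) :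
    deriv (fun y : ℝ => y ^ a * Real.exp (-1 / y)) y =
      a * (y ^ (a - 1) * Real.exp (-1 / y)) + y ^ (a - 2) * Real.exp (-1 / y) := by
  have h1 : HasDerivAt (fun y : ℝ => y ^ a) (a * y ^ (a - 1)) y :=
    Real.hasDerivAt_rpow_const (Or.inl hy.ne')
  have h2 : HasDerivAt (fun y : ℝ => -1 / y) (1 / y ^ 2) y := by
    have := (hasDerivAt_const y (-1 : ℝ)).div (hasDerivAt_id y) hy.ne'
    refine HasDerivAt.congr_deriv this ?_
    simp
  have h3 := (h1.mul h2.exp).deriv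
  have h4 : y ^ (a - 2) = y ^ a / y ^ 2 := by
    rw [Real.rpow_sub hy]; norm_num
  rw [h4]
  refine Eq.trans h3 ?_
  ring

lemma auxG_A {x : ℝ} (hx : 0 < x) (j : ℕ) (a : ℝ) :
    auxG x (j + 1) a = a * auxG x j (a - 1) + auxG x j (a - 2) := by
  unfold auxG
  rw [iteratedDeriv_succ']
  have he : deriv (fun y : ℝ => y ^ a * Real.exp (-1 / y)) =ᶠ[nhds x]
      (fun y : ℝ => a * (y ^ (a - 1) * Real.exp (-1 / y)))
        + (fun y : ℝ => y ^ (a - 2) * Real.exp (-1 / y)) := by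
    filter_upwards [lt_mem_nhds hx] with y hy
    exact auxF_deriv hy a
  rw [he.iteratedDeriv_eq, iteratedDeriv_add (contDiffAt_const.mul (auxF_contDiffAt hx _ _))
    (auxF_contDiffAt hx _ _), iteratedDeriv_const_mul_field]

lemma auxG_zero {x : ℝ} (hx : 0 < x) (a : ℝ) : auxG x 0 (a + 1) = x * auxG x 0 a := by
  simp only [auxG, iteratedDeriv_zero]
  rw [Real.rpow_add_one hx.ne']
  ring

lemma auxG_B {x : ℝ} (hx : 0 < x) (j : ℕ) : ∀ a : ℝ,
    auxG x (j + 1) (a + 1) = x * auxG x (j + 1) a + (j + 1) * auxG x j a := by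
  induction j with
  | zero =>
    intro a
    have e1 := auxG_A hx 0 (a + 1)
    have e2 := auxG_A hx 0 a
    have e3 := auxG_zero hx (a - 1)
    have e4 := auxG_zero hx (a - 2)
    rw [show a + 1 - 1 = a by ring, show a + 1 - 2 = a - 1 by ring] at e1
    rw [show a - 1 + 1 = a by ring] at e3
    rw [show a - 2 + 1 = a - 1 by ring] at e4
    rw [e1, e2, Nat.cast_zero]
    linear_combination a * e3 + e4
  | succ j ih =>
    intro a
    have e1 := auxG_A hx (j + 1) (a + 1)
    have e2 := auxG_A hx (j + 1) a
    have e3 := ih (a - 1)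
    have e4 := ih (a - 2)
    have e5 := auxG_A hx j a
    rw [show a + 1 - 1 = a by ring, show a + 1 - 2 = a - 1 by ring] at e1
    rw [show a - 1 + 1 = a by ring] at e3
    rw [show a - 2 + 1 = a - 1 by ring] at e4
    rw [e1, e2]
    push_cast
    linear_combination a * e3 + e4 - (j + 1) * e5

lemma finiteN_eq_s10 (q : ℝ) (k : ℕ) (x : ℝ) :
    finiteN q k x = (-1 : ℝ) ^ k * x ^ q * Real.exp (1 / x) * auxG x k (2 * (k : ℝ) - q) := rfl

lemma finiteN_rec {x : ℝ} (hx : 0 < x) (q : ℝ) (k : ℕ) (h1 : q - 1 - k ≠ 0) (h2 : q - 2 * k ≠ 0) :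
    finiteN q (k + 1) x =
      ((q - 2 * k - 2) * (q - 2 * k - 1) / (q - 1 - k) * x
        - q * (q - 2 * k - 1) / ((q - 1 - k) * (q - 2 * k))) * finiteN q k x
      - k * (q - 2 * k - 2) / ((q - 1 - k) * (q - 2 * k)) * finiteN q (k - 1) x := by
  rcases k with _ | j
  · have e1 := auxG_A hx 0 (2 - q)
    have e2 := auxG_zero hx (-q)
    rw [show 2 - q - 1 = -q + 1 by ring, show 2 - q - 2 = -q by ring, e2] at e1
    simp only [finiteN_eq_s10, zero_add, Nat.cast_zero, Nat.cast_one, mul_one, mul_zero, zero_sub] at *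
    rw [e1]
    simp only [sub_zero] at *
    field_simp
    ring
  · have a1 := auxG_A hx (j + 1) (2 * ((j : ℝ) + 1) - q + 2)
    have b1 := auxG_B hx j (2 * ((j : ℝ) + 1) - q)
    have a2 := auxG_A hx j (2 * ((j : ℝ) + 1) - q)
    have a3 := auxG_A hx j (2 * ((j : ℝ) + 1) - q + 1)
    simp only [finiteN_eq_s10, Nat.add_sub_cancel]
    push_cast at *
    rw [show 2 * ((j : ℝ) + 1 + 1) - q = 2 * ((j : ℝ) + 1) - q + 2 by ring,
      show 2 * (j : ℝ) - q = 2 * ((j : ℝ) + 1) - q - 2 by ring]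
    obtain ⟨a, ha⟩ : ∃ a, a = 2 * ((j : ℝ) + 1) - q := ⟨_, rfl⟩
    rw [← ha] at a1 b1 a2 a3 ⊢
    obtain rfl : q = 2 * ((j : ℝ) + 1) - a := by linarith
    rw [show a + 2 - 1 = a + 1 by ring, show a + 2 - 2 = a by ring] at a1
    rw [show a + 1 - 1 = a by ring, show a + 1 - 2 = a - 1 by ring] at a3
    generalize auxG x (j + 1 + 1) (a + 2) = A at *
    generalize auxG x (j + 1) (a + 1) = B at *
    generalize auxG x (j + 1) a = C at *
    generalize auxG x j a = D at *
    generalize auxG x j (a - 1) = E at *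
    generalize auxG x j (a - 2) = F at *
    generalize x ^ (2 * ((j : ℝ) + 1) - a) = X
    generalize Real.exp (1 / x) = Y
    have k1 : (j : ℝ) - a ≠ 0 := by intro h; apply h1; linarith
    have k2 : a ≠ 0 := by intro h; apply h2; linarith
    have hE : E = (C - F) / a := by field_simp; linarith
    have hD : D = (E - x * C) / (j - a) := by
      field_simp
      linear_combination a3 - b1
    rw [show 2 * ((j : ℝ) + 1) - a - 1 - (j + 1) = j - a by ring,
      show 2 * ((j : ℝ) + 1) - a - 2 * (j + 1) = -a by ring]
    rw [a1, b1, hD, hE]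
    simp only [pow_succ]
    field_simp
    ring

theorem stmt10 (d : ℕ) (hd : 1 ≤ d) (μ : ℝ) (α : ℝ) (hα : α = μ + ((d : ℝ) - 1) / 2)
    (m n : ℕ) (hmn : m ≤ n) (P : (Fin d → ℝ) → ℝ) (p : ℝ)
    (h1 : p - 2 * μ - m - n - d ≠ 0) (h2 : p - 2 * μ - 2 * n - d + 1 ≠ 0)
    (N : ℕ → (Fin d → ℝ) → ℝ → ℝ)
    (hN : ∀ (ν : ℕ) (x : Fin d → ℝ) (t : ℝ),
      N ν x t = finiteN (p - 2 * α - 2 * m) (ν - m) t * t ^ m * P (t⁻¹ • x)) :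
    ∀ (x : Fin d → ℝ) (t : ℝ), 0 < t →
      N (n + 1) x t =
        ((p - 2 * μ - 2 * n - d - 1) * (p - 2 * μ - 2 * n - d) / (p - 2 * μ - m - n - d) * t
          - (p - 2 * μ - 2 * m - d + 1) * (p - 2 * μ - 2 * n - d) /
              ((p - 2 * μ - m - n - d) * (p - 2 * μ - 2 * n - d + 1))) * N n x t
        - (((n : ℝ) - m) * (p - 2 * μ - 2 * n - d - 1) /
            ((p - 2 * μ - m - n - d) * (p - 2 * μ - 2 * n - d + 1))) * N (n - 1) x t := by
  intro x t ht
  obtain ⟨k, rfl⟩ := Nat.exists_eq_add_of_le hmn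
  simp only [hN]
  have hq : p - 2 * μ - d = p - 2 * α - 2 * m + 2 * m - 1 := by rw [hα]; ring
  rw [show m + k + 1 - m = k + 1 by omega, show m + k - m = k by omega,
    show m + k - 1 - m = k - 1 by omega]
  generalize p - 2 * α - 2 * m = q at *
  obtain rfl : p = q + 2 * m - 1 + 2 * μ + d := by linarith
  push_cast at *
  have h := finiteN_rec ht q k (by intro h; apply h1; linarith) (by intro h; apply h2; linarith)
  rw [h]
  ring_nf
end

section
/- Let d ≥ 2 be an integer, let m ≤ n and m′ ≤ n′ be natural numbers, and let p, q be real numbers with p > 2·max(n,n′) + d and q > −d. Let Y and Y′ be spherical harmonics of degrees m and m′ respectively. Set b_{p,q} := c_{p−d+1, q+d−1}/ω_d. Then b_{p,q} · ∫_0^∞ ( ∫_{S^{d−1}} M_{n−m}^{(p−2m−d+1, q+2m+d−1)}(t) Y(tξ) · M_{n′−m′}^{(p−2m′−d+1, q+2m′+d−1)}(t) Y′(tξ) dσ(ξ) ) t^{q+d−1} (1+t)^{−(p+q)} dt equals ( c_{p−d+1, q+d−1}/c_{p−2m−d+1, q+2m+d−1} ) · h_{n−m}^{(p−2m−d+1,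 q+2m+d−1)} · ( (1/ω_d) ∫_{S^{d−1}} Y(ξ)Y′(ξ) dσ(ξ) ) if n = n′ and m = m′, and equals 0 otherwise. -/
open MeasureTheory Real

/-- The surface area `ω_d = 2 π^{d/2} / Γ(d/2)` of the unit sphere `S^{d-1}`. -/
noncomputable def omegaSphere (d : ℕ) : ℝ :=
  2 * Real.pi ^ ((d : ℝ) / 2) / Real.Gamma ((d : ℝ) / 2)

/-- The surface measure on the unit sphere `S^{d-1} ⊆ ℝ^d`. -/
noncomputable def sphereMeasure (d : ℕ) :
    Measure (Metric.sphere (0 : EuclideanSpace ℝ (Fin d)) 1) :=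
  (volume : Measure (EuclideanSpace ℝ (Fin d))).toSphere

/-- A spherical harmonic of degree `m`: a homogeneous polynomial of degree `m` on `ℝ^d`
that is annihilated by the Laplacian. -/
def IsSphericalHarmonic (d m : ℕ) (Y : MvPolynomial (Fin d) ℝ) : Prop :=
  Y.IsHomogeneous m ∧ ∑ i : Fin d, MvPolynomial.pderiv i (MvPolynomial.pderiv i Y) = 0

/-- Gaussian weight on `ℝ^d` (product form). -/
noncomputable def gau {d : ℕ} (x : Fin d → ℝ) : ℝ := Real.exp (-∑ i, x i ^ 2)

lemma integrable_pow_gauss (k : ℕ) : Integrable fun x : ℝ => x ^ k * Real.exp (-x ^ 2) := by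
  have := integrable_rpow_mul_exp_neg_mul_sq (b := 1) one_pos (s := k)
    (by have : (0:ℝ) ≤ k := Nat.cast_nonneg k
        linarith)
  simpa using this

lemma integrable_gau {d : ℕ} (P : MvPolynomial (Fin d) ℝ) :
    Integrable fun x : Fin d → ℝ => MvPolynomial.eval x P * gau x := by
  induction P using MvPolynomial.induction_on' with
  | monomial u a =>
    have h : Integrable (fun x : Fin d → ℝ => ∏ i, (x i ^ u i * Real.exp (-x i ^ 2))) :=
      Integrable.fintype_prod (f := fun i x => x ^ u i * Real.exp (-x ^ 2))
        fun i => integrable_pow_gauss (u i)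
    refine (h.const_mul a).congr (.of_forall fun x => ?_)
    simp only [MvPolynomial.eval_monomial, gau, Finset.prod_mul_distrib, ← Real.exp_sum,
      Finset.sum_neg_distrib]
    rw [Finsupp.prod_fintype _ _ (by simp)]
    ring
  | add p q hp hq =>
    refine (hp.add hq).congr (.of_forall fun x => ?_)
    simp [add_mul]

lemma lineDeriv_eval {d : ℕ} (P : MvPolynomial (Fin d) ℝ) (i : Fin d) (x : Fin d → ℝ) :
    HasLineDerivAt ℝ (fun y => MvPolynomial.eval y P) (MvPolynomial.eval x (MvPolynomial.pderiv i P))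
      x (Pi.single i 1) := by
  unfold HasLineDerivAt
  induction P using MvPolynomial.induction_on with
  | C a => simpa using hasDerivAt_const (0:ℝ) a
  | add p q hp hq => exact (by simpa using HasDerivAt.fun_add hp hq)
  | mul_X p j hp =>
    have hX : HasDerivAt (fun t : ℝ => (x + t • (Pi.single i 1 : Fin d → ℝ)) j)
        ((Pi.single i 1 : Fin d → ℝ) j) 0 := by
      simpa using ((hasDerivAt_id (0:ℝ)).mul_const ((Pi.single i 1 : Fin d → ℝ) j)).const_add (x j)
    have := hp.mul hX
    convert! this using 1
    · ext t; simp
    · simp [MvPolynomial.pderiv_X, Pi.single_apply]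
      split_ifs <;> simp_all <;> ring

lemma lineDeriv_gau {d : ℕ} (i : Fin d) (x : Fin d → ℝ) :
    HasLineDerivAt ℝ (gau (d := d)) (-2 * x i * gau x) x (Pi.single i 1) := by
  have h := lineDeriv_eval (∑ j, MvPolynomial.X j ^ 2) i x
  unfold HasLineDerivAt at *
  have h2 := h.neg.exp
  convert! h2 using 1
  · ext t; simp [gau]
  · simp [gau, MvPolynomial.pderiv_X, Pi.single_apply]
    ring

lemma gau_parts {d : ℕ} (P : MvPolynomial (Fin d) ℝ) (i : Fin d) :
    ∫ x : Fin d → ℝ, MvPolynomial.eval x (MvPolynomial.pderiv i P - 2 * (MvPolynomial.X i * P)) * gau x = 0 := by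
  have e1 : ∀ x : Fin d → ℝ, MvPolynomial.eval x P * (-2 * x i * gau x)
      = MvPolynomial.eval x (-2 * MvPolynomial.X i * P) * gau x := by
    intro x; simp; ring
  have := integral_bilinear_hasLineDerivAt_right_eq_neg_left_of_integrable (μ := volume)
    (f := fun x : Fin d → ℝ => MvPolynomial.eval x P) (g := gau)
    (f' := fun x => MvPolynomial.eval x (MvPolynomial.pderiv i P))
    (g' := fun x => -2 * x i * gau x)
    (v := Pi.single i 1) (B := ContinuousLinearMap.mul ℝ ℝ)
    (by simpa using integrable_gau (MvPolynomial.pderiv i P))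
    (by simp only [ContinuousLinearMap.mul_apply', e1]
        exact integrable_gau _)
    (by simpa using integrable_gau P)
    (fun x _ => lineDeriv_eval P i x) (fun x _ => lineDeriv_gau i x)
  simp only [ContinuousLinearMap.mul_apply', e1] at this
  rw [eq_neg_iff_add_eq_zero, ← integral_add (integrable_gau _) (integrable_gau _)] at this
  rw [← this]
  congr 1; ext x; simp; ring

lemma orth_gau {d m m' : ℕ} (Y Y' : MvPolynomial (Fin d) ℝ)
    (hY : Y.IsHomogeneous m) (hL : ∑ i : Fin d, MvPolynomial.pderiv i (MvPolynomial.pderiv i Y) = 0)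
    (hY' : Y'.IsHomogeneous m') (hL' : ∑ i : Fin d, MvPolynomial.pderiv i (MvPolynomial.pderiv i Y') = 0)
    (hne : m ≠ m') : ∫ x : Fin d → ℝ, MvPolynomial.eval x (Y * Y') * gau x = 0 := by
  let F : Fin d → MvPolynomial (Fin d) ℝ := fun i =>
    MvPolynomial.pderiv i Y * Y' - Y * MvPolynomial.pderiv i Y'
  have h1 : ∑ i, (MvPolynomial.pderiv i (F i) - 2 * (MvPolynomial.X i * F i))
      = MvPolynomial.C (-2 * ((m:ℝ) - m')) * (Y * Y') := by
    have e : ∀ i, MvPolynomial.pderiv i (F i) - 2 * (MvPolynomial.X i * F i)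
      = MvPolynomial.pderiv i (MvPolynomial.pderiv i Y) * Y' - Y * MvPolynomial.pderiv i (MvPolynomial.pderiv i Y')
        - 2 * ((MvPolynomial.X i * MvPolynomial.pderiv i Y) * Y' - Y * (MvPolynomial.X i * MvPolynomial.pderiv i Y')) := by
      intro i
      simp only [F, map_sub, Derivation.leibniz, smul_eq_mul]
      ring
    simp only [e, Finset.sum_sub_distrib, ← Finset.sum_mul, ← Finset.mul_sum, hL, hL',
      hY.sum_X_mul_pderiv, hY'.sum_X_mul_pderiv]
    simp only [nsmul_eq_mul, map_mul, map_sub, map_neg, map_natCast, map_ofNat]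
    ring
  have h2 : ∑ i, ∫ x : Fin d → ℝ, MvPolynomial.eval x (MvPolynomial.pderiv i (F i) - 2 * (MvPolynomial.X i * F i)) * gau x = 0 :=
    Finset.sum_eq_zero fun i _ => gau_parts (F i) i
  rw [← integral_finsetSum _ (fun i _ => integrable_gau _)] at h2
  simp only [← Finset.sum_mul, ← map_sum, h1] at h2
  simp only [map_mul, MvPolynomial.eval_C, mul_assoc, integral_const_mul] at h2
  have h3 : (m:ℝ) - m' ≠ 0 := sub_ne_zero.2 (by exact_mod_cast hne)
  simpa [h3, mul_assoc] using h2

lemma eval_homog {d m : ℕ} {Y : MvPolynomial (Fin d) ℝ} (hY : Y.IsHomogeneous m) (t : ℝ) (x : Fin d → ℝ) :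
    MvPolynomial.eval (fun i => t * x i) Y = t ^ m * MvPolynomial.eval x Y := by
  rw [MvPolynomial.eval_eq, MvPolynomial.eval_eq, Finset.mul_sum]
  refine Finset.sum_congr rfl fun u hu => ?_
  have h := hY (MvPolynomial.mem_support_iff.1 hu)
  have h' : ∑ i, u i = m := by
    rw [← h, Finsupp.weight_apply, Finsupp.sum_fintype _ _ (by simp)]; simp
  have e : ∏ i ∈ u.support, (t * x i) ^ u i = ∏ i, (t * x i) ^ u i :=
    Finset.prod_subset (Finset.subset_univ _) (by intro i _ hi; simp at hi; simp [hi])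
  have e' : ∏ i ∈ u.support, (x i) ^ u i = ∏ i, (x i) ^ u i :=
    Finset.prod_subset (Finset.subset_univ _) (by intro i _ hi; simp at hi; simp [hi])
  rw [e, e']
  simp only [mul_pow, Finset.prod_mul_distrib, Finset.prod_pow_eq_pow_sum, h']
  ring

lemma polar_gau {d k : ℕ} (hd : 2 ≤ d) (P : MvPolynomial (Fin d) ℝ) (hP : P.IsHomogeneous k) :
    ∫ x : Fin d → ℝ, MvPolynomial.eval x P * gau x =
      (∫ ξ : Metric.sphere (0 : EuclideanSpace ℝ (Fin d)) 1,
        MvPolynomial.eval (fun i => (ξ : EuclideanSpace ℝ (Fin d)) i) P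
          ∂(volume : Measure (EuclideanSpace ℝ (Fin d))).toSphere) *
      ∫ r in Set.Ioi (0:ℝ), r ^ (d - 1) * (r ^ k * Real.exp (-r ^ 2)) := by
  have : NeZero d := ⟨by omega⟩
  let μ : Measure (EuclideanSpace ℝ (Fin d)) := volume
  let f : EuclideanSpace ℝ (Fin d) → ℝ := fun x => MvPolynomial.eval (fun i => x i) P * Real.exp (-‖x‖^2)
  have hf : ∀ x : Fin d → ℝ, MvPolynomial.eval x P * gau x = f (WithLp.toLp 2 x) := by
    intro x
    simp [f, gau, EuclideanSpace.norm_sq_eq]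
  simp only [hf]
  rw [(PiLp.volume_preserving_toLp (Fin d)).integral_comp (MeasurableEquiv.toLp 2 _).measurableEmbedding]
  calc
    ∫ x, f x = ∫ x : ({(0)}ᶜ : Set (EuclideanSpace ℝ (Fin d))), f x.1 ∂(μ.comap (↑)) := by
      rw [integral_subtype_comap (measurableSet_singleton _).compl f,
        restrict_compl_singleton]
    _ = ∫ x : Metric.sphere (0 : EuclideanSpace ℝ (Fin d)) 1 × Set.Ioi (0:ℝ),
        MvPolynomial.eval (fun i => (x.1 : EuclideanSpace ℝ (Fin d)) i) P * ((x.2:ℝ) ^ k * Real.exp (-(x.2:ℝ)^2))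
        ∂μ.toSphere.prod (.volumeIoiPow (Module.finrank ℝ (EuclideanSpace ℝ (Fin d)) - 1)) := by
      rw [← μ.measurePreserving_homeomorphUnitSphereProd.integral_comp
        (Homeomorph.measurableEmbedding _)]
      congr 1
      ext x
      have hx : ‖x.1‖ ≠ 0 := norm_ne_zero_iff.2 x.2
      have h1 := eval_homog hP ‖x.1‖ (fun i => ‖x.1‖⁻¹ * x.1 i)
      simp only [mul_inv_cancel_left₀ hx] at h1
      simp only [homeomorphUnitSphereProd_apply_snd_coe, homeomorphUnitSphereProd_apply_fst_coe, f,
        PiLp.smul_apply, smul_eq_mul]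
      rw [h1]; ring
    _ = _ := by
      rw [integral_prod_mul (fun ξ : Metric.sphere (0 : EuclideanSpace ℝ (Fin d)) 1 =>
        MvPolynomial.eval (fun i => (ξ : EuclideanSpace ℝ (Fin d)) i) P)
        (fun r : Set.Ioi (0:ℝ) => (r:ℝ) ^ k * Real.exp (-(r:ℝ)^2))]
      congr 1
      simp only [Measure.volumeIoiPow, ENNReal.ofReal]
      rw [integral_withDensity_eq_integral_smul,
        integral_subtype_comap measurableSet_Ioi fun a : ℝ ↦ Real.toNNReal (a ^ (Module.finrank ℝ (EuclideanSpace ℝ (Fin d)) - 1)) • (a ^ k * Real.exp (-a^2)),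
        setIntegral_congr_fun measurableSet_Ioi fun x hx ↦ ?_]
      · simp only [NNReal.smul_def]
        rw [Real.coe_toNNReal _ (pow_nonneg (le_of_lt hx) _)]
        simp
      · exact (measurable_subtype_coe.pow_const _).real_toNNReal

lemma radial_pos (d k : ℕ) : 0 < ∫ r in Set.Ioi (0:ℝ), r ^ (d - 1) * (r ^ k * Real.exp (-r ^ 2)) := by
  have e : ∀ r : ℝ, r ^ (d - 1) * (r ^ k * Real.exp (-r ^ 2)) = r ^ (d-1+k) * Real.exp (-r^2) := by
    intro r; rw [pow_add]; ring
  simp only [e]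
  rw [setIntegral_pos_iff_support_of_nonneg_ae]
  · have : Set.Ioi (0:ℝ) ⊆ (Function.support fun r : ℝ => r ^ (d-1+k) * Real.exp (-r^2)) ∩ Set.Ioi 0 := by
      intro r hr
      have hr' : 0 < r := hr
      refine ⟨?_, hr⟩
      simp only [Function.mem_support]
      positivity
    refine lt_of_lt_of_le ?_ (measure_mono this)
    simp
  · refine (ae_restrict_iff' measurableSet_Ioi).2 (.of_forall fun x hx => ?_)
    have : 0 < x := hx
    simp only [Pi.zero_apply]
    positivity
  · exact (integrable_pow_gauss _).integrableOn

lemma orth_sphere {d m m' : ℕ} (hd : 2 ≤ d) (Y Y' : MvPolynomial (Fin d) ℝ)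
    (hY : Y.IsHomogeneous m) (hL : ∑ i : Fin d, MvPolynomial.pderiv i (MvPolynomial.pderiv i Y) = 0)
    (hY' : Y'.IsHomogeneous m') (hL' : ∑ i : Fin d, MvPolynomial.pderiv i (MvPolynomial.pderiv i Y') = 0)
    (hne : m ≠ m') :
    ∫ ξ : Metric.sphere (0 : EuclideanSpace ℝ (Fin d)) 1,
        MvPolynomial.eval (fun i => (ξ : EuclideanSpace ℝ (Fin d)) i) Y *
        MvPolynomial.eval (fun i => (ξ : EuclideanSpace ℝ (Fin d)) i) Y'
          ∂(volume : Measure (EuclideanSpace ℝ (Fin d))).toSphere = 0 := by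
  have h := orth_gau Y Y' hY hL hY' hL' hne
  rw [polar_gau hd _ (hY.mul hY')] at h
  simpa [(radial_pos d (m+m')).ne'] using h

lemma beta_real_integrable {s t : ℝ} (hs : 0 < s) (ht : 0 < t) :
    IntegrableOn (fun u : ℝ => u ^ (s-1) * (1-u) ^ (t-1)) (Set.Ioo 0 1) ∧
    ∫ u in Set.Ioo (0:ℝ) 1, u ^ (s-1) * (1-u) ^ (t-1)
      = Real.Gamma s * Real.Gamma t / Real.Gamma (s+t) := by
  have h1 := Complex.betaIntegral_convergent (u := s) (v := t) (by simpa) (by simpa)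
  have e : ∀ x ∈ Set.Ioo (0:ℝ) 1, (x:ℂ) ^ ((s:ℂ) - 1) * (1 - (x:ℂ)) ^ ((t:ℂ) - 1)
      = ((x ^ (s-1) * (1-x) ^ (t-1) : ℝ) : ℂ) := by
    intro x hx
    have h0 : 0 ≤ 1 - x := by linarith [hx.2]
    push_cast
    rw [Complex.ofReal_cpow hx.1.le, Complex.ofReal_cpow h0]
    push_cast; rfl
  rw [intervalIntegrable_iff_integrableOn_Ioo_of_le zero_le_one] at h1
  have h2 : IntegrableOn (fun x : ℝ => ((x ^ (s-1) * (1-x) ^ (t-1) : ℝ) : ℂ)) (Set.Ioo 0 1) :=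
    (integrableOn_congr_fun e measurableSet_Ioo).1 h1
  constructor
  · have := h2.re
    simp only [RCLike.re_to_complex, Complex.ofReal_re] at this
    exact this
  · have h3 := ProbabilityTheory.beta_eq_betaIntegralReal s t hs ht
    rw [ProbabilityTheory.beta] at h3
    rw [h3, Complex.betaIntegral, intervalIntegral.integral_of_le zero_le_one,
      integral_Ioc_eq_integral_Ioo, setIntegral_congr_fun measurableSet_Ioo e, integral_complex_ofReal]
    simp

lemma beta_Ioi {s t : ℝ} (hs : 0 < s) (ht : 0 < t) :
    IntegrableOn (fun x : ℝ => x ^ (s-1) * (1+x) ^ (-(s+t))) (Set.Ioi 0) ∧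
    ∫ x in Set.Ioi (0:ℝ), x ^ (s-1) * (1+x) ^ (-(s+t))
      = Real.Gamma s * Real.Gamma t / Real.Gamma (s+t) := by
  have him : (fun u : ℝ => u / (1-u)) '' Set.Ioo 0 1 = Set.Ioi 0 := by
    ext x
    constructor
    · rintro ⟨u, hu, rfl⟩
      exact div_pos hu.1 (by linarith [hu.2])
    · intro hx
      have hx : 0 < x := hx
      refine ⟨x / (1+x), ⟨by positivity, ?_⟩, ?_⟩
      · rw [div_lt_one (by positivity)]; linarith
      · simp only
        field_simp
        simp
  have hder : ∀ u ∈ Set.Ioo (0:ℝ) 1,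
      HasDerivWithinAt (fun u : ℝ => u / (1-u)) (1/(1-u)^2) (Set.Ioo 0 1) u := by
    intro u hu
    have h0 : 1 - u ≠ 0 := by linarith [hu.2]
    have := ((hasDerivAt_id u).div ((hasDerivAt_id u).const_sub 1) h0)
    convert! this.hasDerivWithinAt using 1
    simp
  have hinj : Set.InjOn (fun u : ℝ => u / (1-u)) (Set.Ioo 0 1) := by
    intro a ha b hb hab
    have h0 : 1 - a ≠ 0 := by linarith [ha.2]
    have h1 : 1 - b ≠ 0 := by linarith [hb.2]
    simp only at hab
    rw [div_eq_div_iff h0 h1] at hab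
    linarith
  have e : ∀ u ∈ Set.Ioo (0:ℝ) 1, |1/(1-u)^2| • ((u/(1-u)) ^ (s-1) * (1+u/(1-u)) ^ (-(s+t)))
      = u ^ (s-1) * (1-u) ^ (t-1) := by
    intro u hu
    have h0 : 0 < 1 - u := by linarith [hu.2]
    have h1 : 1 + u/(1-u) = (1-u)⁻¹ := by field_simp; ring
    rw [h1, abs_of_pos (by positivity), div_rpow hu.1.le h0.le, inv_rpow h0.le, rpow_neg h0.le, inv_inv,
      smul_eq_mul]
    have h2 : (1-u)^(s+t) = (1-u)^(t-1) * (1-u)^(s-1) * (1-u)^2 := by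
      rw [← rpow_natCast, ← rpow_add h0, ← rpow_add h0]; congr 1; push_cast; ring
    rw [h2]
    have := (rpow_pos_of_pos h0 (s-1)).ne'
    field_simp
  have hb := beta_real_integrable hs ht
  constructor
  · rw [← him, integrableOn_image_iff_integrableOn_abs_deriv_smul measurableSet_Ioo hder hinj]
    exact (integrableOn_congr_fun e measurableSet_Ioo).2 hb.1
  · rw [← him, integral_image_eq_integral_abs_deriv_smul measurableSet_Ioo hder hinj,
      setIntegral_congr_fun measurableSet_Ioo e, hb.2]

open Polynomial in
/-- Polynomial growth bound. -/
lemma poly_bound (P : Polynomial ℝ) : ∃ C : ℝ, ∀ x : ℝ, 0 ≤ x →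
    |P.eval x| ≤ C * (1+x) ^ (P.natDegree : ℝ) := by
  refine ⟨∑ i ∈ Finset.range (P.natDegree+1), |P.coeff i|, fun x hx => ?_⟩
  rw [Polynomial.eval_eq_sum_range, Finset.sum_mul, rpow_natCast]
  refine (Finset.abs_sum_le_sum_abs _ _).trans (Finset.sum_le_sum fun i hi => ?_)
  rw [abs_mul, abs_pow, abs_of_nonneg hx]
  have : i ≤ P.natDegree := by simpa [Nat.lt_succ_iff] using hi
  gcongr
  calc x ^ i ≤ (1+x)^i := by gcongr; linarith
    _ ≤ _ := pow_le_pow_right₀ (by linarith) this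

lemma cont_rpow {α β : ℝ} (P : Polynomial ℝ) :
    ContinuousOn (fun x : ℝ => x ^ α * (1+x) ^ β * P.eval x) (Set.Ioi 0) := by
  refine ContinuousOn.mul (ContinuousOn.mul ?_ ?_) P.continuous.continuousOn
  · exact fun x hx => (continuousAt_rpow_const x α (Or.inl (ne_of_gt hx))).continuousWithinAt
  · refine ContinuousOn.rpow_const (by fun_prop) fun x hx => Or.inl ?_
    have : 0 < x := hx
    positivity

lemma integrable_poly {α β : ℝ} (hα : -1 < α) (P : Polynomial ℝ)
    (h : (P.natDegree : ℝ) + α + β < -1) :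
    IntegrableOn (fun x : ℝ => x ^ α * (1+x) ^ β * P.eval x) (Set.Ioi 0) := by
  obtain ⟨C, hC⟩ := poly_bound P
  have hb := (beta_Ioi (s := α+1) (t := -(P.natDegree + α + β) - 1) (by linarith) (by linarith)).1
  have hb' := hb.const_mul C
  refine Integrable.mono' hb' ((cont_rpow P).aestronglyMeasurable measurableSet_Ioi) ?_
  refine (ae_restrict_iff' measurableSet_Ioi).2 (.of_forall fun x hx => ?_)
  have hx : 0 < x := hx
  rw [norm_eq_abs, abs_mul, abs_of_nonneg (by positivity)]
  calc _ ≤ x ^ α * (1+x) ^ β * (C * (1+x) ^ (P.natDegree : ℝ)) := by gcongr; exact hC x hx.le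
    _ = C * (x ^ α * ((1+x) ^ β * (1+x) ^ (P.natDegree : ℝ))) := by ring
    _ = _ := by
      rw [← rpow_add (by positivity)]; congr 3 <;> ring_nf

lemma tendsto_poly {α β : ℝ} (hα : 0 ≤ α) (P : Polynomial ℝ)
    (h : (P.natDegree : ℝ) + α + β < 0) :
    Filter.Tendsto (fun x : ℝ => x ^ α * (1+x) ^ β * P.eval x) Filter.atTop (nhds 0) := by
  obtain ⟨C, hC⟩ := poly_bound P
  have h1 : Filter.Tendsto (fun x : ℝ => C * (1+x) ^ (-(-(P.natDegree + α + β)))) Filter.atTop (nhds (C * 0)) :=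
    ((tendsto_rpow_neg_atTop (by linarith)).comp
      (Filter.tendsto_atTop_add_const_left _ 1 Filter.tendsto_id)).const_mul C
  rw [mul_zero] at h1
  refine squeeze_zero_norm' ?_ h1
  filter_upwards [Filter.eventually_gt_atTop 0] with x hx
  rw [norm_eq_abs, abs_mul, abs_of_nonneg (by positivity)]
  calc _ ≤ (1+x) ^ α * (1+x) ^ β * (C * (1+x) ^ (P.natDegree : ℝ)) := by
        gcongr
        · linarith
        · exact hC x hx.le
    _ = C * ((1+x) ^ α * (1+x) ^ β * (1+x) ^ (P.natDegree : ℝ)) := by ring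
    _ = _ := by
      rw [← rpow_add (by positivity), ← rpow_add (by positivity)]; congr 2; ring

open Polynomial in
/-- `D[x^{a}(1+x)^{b} A] = x^{a-1}(1+x)^{b-1} T_{a,b} A`. -/
noncomputable def TT (a b : ℝ) (A : Polynomial ℝ) : Polynomial ℝ :=
  (C a + C (a+b) * X) * A + (X + X^2) * derivative A

lemma hasDeriv_TT (a b : ℝ) (A : Polynomial ℝ) {x : ℝ} (hx : 0 < x) :
    HasDerivAt (fun x : ℝ => x ^ a * (1+x) ^ b * A.eval x)
      (x ^ (a-1) * (1+x) ^ (b-1) * (TT a b A).eval x) x := by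
  have h1 : HasDerivAt (fun x : ℝ => x ^ a) (a * x ^ (a-1)) x :=
    hasDerivAt_rpow_const (Or.inl hx.ne')
  have h2 : HasDerivAt (fun x : ℝ => (1+x) ^ b) (1 * b * (1+x) ^ (b-1)) x :=
    ((hasDerivAt_id x).const_add 1).rpow_const (Or.inl (by simp; positivity))
  convert! (h1.mul h2).mul (A.hasDerivAt x) using 1
  have e1 : x ^ a = x ^ (a-1) * x := by rw [rpow_sub_one hx.ne']; field_simp
  have e2 : (1+x) ^ b = (1+x) ^ (b-1) * (1+x) := by
    have : (1 + x) ≠ 0 := by positivity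
    rw [rpow_sub_one this]; field_simp
  simp [TT]
  rw [e1, e2]
  ring

lemma natDegree_TT (a b : ℝ) (A : Polynomial ℝ) : (TT a b A).natDegree ≤ A.natDegree + 1 := by
  unfold TT
  refine Polynomial.natDegree_add_le_of_degree_le ?_ ?_
  · refine Polynomial.natDegree_mul_le.trans ?_
    rw [add_comm]; gcongr
    compute_degree
  · by_cases h : A.natDegree = 0
    · have := Polynomial.derivative_of_natDegree_zero h
      simp [this]
    · refine Polynomial.natDegree_mul_le.trans ?_
      have h1 := Polynomial.natDegree_derivative_lt h
      have h2 : (Polynomial.X + Polynomial.X^2 : Polynomial ℝ).natDegree ≤ 2 := by compute_degree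
      omega

lemma coeff_TT (a b : ℝ) (A : Polynomial ℝ) (k : ℕ) (hk : A.natDegree ≤ k) :
    (TT a b A).coeff (k+1) = (a+b+k) * A.coeff k := by
  have h0 : A.coeff (k+1) = 0 := Polynomial.coeff_eq_zero_of_natDegree_lt (by omega)
  have h1 : A.coeff (k+1+1) = 0 := Polynomial.coeff_eq_zero_of_natDegree_lt (by omega)
  have e : TT a b A = Polynomial.C a * A + Polynomial.C (a+b) * (Polynomial.X * A) +
      (Polynomial.X * Polynomial.derivative A + Polynomial.X * (Polynomial.X * Polynomial.derivative A)) := by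
    unfold TT; ring
  rw [e]
  simp only [Polynomial.coeff_add, Polynomial.coeff_C_mul, Polynomial.coeff_X_mul, h0,
    Polynomial.coeff_derivative]
  cases k with
  | zero => simp
  | succ k =>
    simp only [Polynomial.coeff_X_mul, Polynomial.coeff_derivative]
    push_cast; ring

lemma TT_mul (a b : ℝ) (A B : Polynomial ℝ) :
    TT a b (A * B) = A * TT a b B + (Polynomial.X + Polynomial.X^2) * (Polynomial.derivative A * B) := by
  simp [TT]; ring

lemma integral_TT {a b : ℝ} (ha : 0 < a) (P : Polynomial ℝ) (h : (P.natDegree : ℝ) + a + b < 0) :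
    ∫ x in Set.Ioi (0:ℝ), x ^ (a-1) * (1+x) ^ (b-1) * (TT a b P).eval x = 0 := by
  have hd : ((TT a b P).natDegree : ℝ) ≤ P.natDegree + 1 := by exact_mod_cast natDegree_TT a b P
  rw [integral_Ioi_of_hasDerivAt_of_tendsto (f := fun x : ℝ => x ^ a * (1+x) ^ b * P.eval x) (m := 0) ?_
    (fun x hx => hasDeriv_TT a b P hx) (integrable_poly (by linarith) _ (by linarith))
    (tendsto_poly ha.le P h)]
  · simp [zero_rpow ha.ne']
  · refine ContinuousAt.continuousWithinAt ?_
    refine ContinuousAt.mul (ContinuousAt.mul ?_ ?_) P.continuous.continuousAt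
    · exact continuousAt_rpow_const _ _ (Or.inr ha.le)
    · exact ContinuousAt.rpow_const (by fun_prop) (Or.inl (by norm_num))

/-- iterated polynomials -/
noncomputable def RR (a b : ℝ) : ℕ → Polynomial ℝ
  | 0 => 1
  | (j+1) => TT (a-j) (b-j) (RR a b j)

lemma natDegree_RR (a b : ℝ) (j : ℕ) : (RR a b j).natDegree ≤ j := by
  induction j with
  | zero => simp [RR]
  | succ j ih => exact (natDegree_TT _ _ _).trans (by omega)

lemma coeff_RR (a b : ℝ) (j : ℕ) :
    (RR a b j).coeff j = ∏ i ∈ Finset.range j, (a + b - i) := by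
  induction j with
  | zero => simp [RR]
  | succ j ih =>
    rw [RR, coeff_TT _ _ _ _ (natDegree_RR a b j), ih, Finset.prod_range_succ]; ring

lemma iteratedDeriv_RR (a b : ℝ) (j : ℕ) : ∀ x : ℝ, 0 < x →
    iteratedDeriv j (fun y : ℝ => y ^ a * (1+y) ^ b) x
      = x ^ (a-j) * (1+x) ^ (b-j) * (RR a b j).eval x := by
  induction j with
  | zero => intro x hx; simp [RR]
  | succ j ih =>
    intro x hx
    rw [iteratedDeriv_succ]
    have : iteratedDeriv j (fun y : ℝ => y ^ a * (1+y) ^ b) =ᶠ[nhds x]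
        fun x => x ^ (a-j) * (1+x) ^ (b-j) * (RR a b j).eval x := by
      filter_upwards [lt_mem_nhds hx] with y hy using ih y hy
    rw [this.deriv_eq, (hasDeriv_TT _ _ _ hx).deriv, RR]
    push_cast
    rw [sub_sub, sub_sub]

lemma parts_RR (a b : ℝ) (n : ℕ) : ∀ A : Polynomial ℝ, (n:ℝ) - 1 < a →
    (A.natDegree : ℝ) + a + b - n < -1 →
    ∫ x in Set.Ioi (0:ℝ), x ^ (a-n) * (1+x) ^ (b-n) * (A * RR a b n).eval x
      = (-1)^n * ∫ x in Set.Ioi (0:ℝ), x ^ a * (1+x) ^ b * ((Polynomial.derivative^[n] A).eval x) := by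
  induction n with
  | zero => intro A _ _; simp [RR]
  | succ n ih =>
    intro A ha hA
    push_cast at ha hA
    have hR : ((RR a b n).natDegree : ℝ) ≤ n := by exact_mod_cast natDegree_RR a b n
    have hprod : ((A * RR a b n).natDegree : ℝ) ≤ A.natDegree + (RR a b n).natDegree := by
      exact_mod_cast Polynomial.natDegree_mul_le
    have h0 := integral_TT (a := a - n) (b := b - n) (by linarith) (A * RR a b n) (by linarith)
    rw [TT_mul] at h0
    by_cases hdeg : A.natDegree = 0
    · have hA' := Polynomial.derivative_of_natDegree_zero hdeg
      rw [hA'] at h0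
      simp only [zero_mul, mul_zero, add_zero] at h0
      rw [Function.iterate_succ_apply, hA', Polynomial.iterate_derivative_zero]
      simp only [Polynomial.eval_zero, mul_zero, integral_zero]
      rw [RR]
      push_cast
      simp only [← sub_sub]
      exact h0
    have hdd : ((Polynomial.derivative A).natDegree : ℝ) + 1 ≤ A.natDegree := by
      exact_mod_cast Polynomial.natDegree_derivative_lt hdeg
    have hstep := ih (Polynomial.derivative A) (by linarith) (by linarith)
    have hT : ((A * TT (a-n) (b-n) (RR a b n)).natDegree : ℝ) ≤ A.natDegree + (n + 1) := by
      have := natDegree_TT (a-n) (b-n) (RR a b n)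
      have h2 := natDegree_RR a b n
      have h3 : (A * TT (a-n) (b-n) (RR a b n)).natDegree ≤ A.natDegree + (n+1) :=
        Polynomial.natDegree_mul_le.trans (by omega)
      exact_mod_cast h3
    have hD : ((Polynomial.derivative A * RR a b n).natDegree : ℝ) ≤ A.natDegree - 1 + n := by
      have : ((Polynomial.derivative A * RR a b n).natDegree : ℝ) ≤
        (Polynomial.derivative A).natDegree + (RR a b n).natDegree := by
        exact_mod_cast Polynomial.natDegree_mul_le
      linarith
    have e : ∀ x ∈ Set.Ioi (0:ℝ), x ^ (a-n-1) * (1+x) ^ (b-n-1) *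
        (A * TT (a-n) (b-n) (RR a b n) + (Polynomial.X + Polynomial.X^2) * (Polynomial.derivative A * RR a b n)).eval x
        = x ^ (a-n-1) * (1+x) ^ (b-n-1) * (A * TT (a-n) (b-n) (RR a b n)).eval x
          + x ^ (a-n) * (1+x) ^ (b-n) * (Polynomial.derivative A * RR a b n).eval x := by
      intro x hx
      have hx : 0 < x := hx
      have h1 : 1 + x ≠ 0 := by positivity
      rw [rpow_sub_one hx.ne' (a-n), rpow_sub_one h1 (b-n)]
      simp only [Polynomial.eval_add, Polynomial.eval_mul, Polynomial.eval_pow, Polynomial.eval_X]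
      field_simp
    rw [setIntegral_congr_fun measurableSet_Ioi e, integral_add
      (integrable_poly (by linarith) _ (by linarith)) (integrable_poly (by linarith) _ (by linarith)), hstep] at h0
    rw [Function.iterate_succ_apply, RR, pow_succ]
    push_cast
    simp only [← sub_sub]
    linarith

lemma gamma_add_nat {s : ℝ} (hs : 0 < s) (n : ℕ) :
    Real.Gamma (s + n) = (ascPochhammer ℝ n).eval s * Real.Gamma s := by
  induction n with
  | zero => simp
  | succ n ih =>
    have : s + n ≠ 0 := by positivity
    push_cast
    rw [← add_assoc, Real.Gamma_add_one this, ih, ascPochhammer_succ_eval]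
    ring

lemma prod_eq_asc (s : ℝ) (n : ℕ) :
    (ascPochhammer ℝ n).eval s = ∏ i ∈ Finset.range n, (s + i) := by
  induction n with
  | zero => simp
  | succ n ih => rw [ascPochhammer_succ_eval, ih, Finset.prod_range_succ]

/-- Polynomial form of `finiteM`. -/
noncomputable def polyM (p q : ℝ) (n : ℕ) : Polynomial ℝ :=
  Polynomial.C ((-1)^n) * RR (n+q) (n-p-q) n

lemma finiteM_eq (p q : ℝ) (n : ℕ) {x : ℝ} (hx : 0 < x) :
    finiteM p q n x = (polyM p q n).eval x := by
  have h1 : 0 < 1 + x := by positivity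
  rw [finiteM, iteratedDeriv_RR _ _ _ x hx, polyM, Polynomial.eval_mul, Polynomial.eval_C,
    show (n:ℝ) + q - n = q by ring, show (n:ℝ) - p - q - n = -(p+q) by ring, rpow_neg h1.le, rpow_neg hx.le]
  have := (rpow_pos_of_pos h1 (p+q)).ne'
  have := (rpow_pos_of_pos hx q).ne'
  field_simp

lemma natDegree_polyM (p q : ℝ) (n : ℕ) : (polyM p q n).natDegree ≤ n :=
  (Polynomial.natDegree_C_mul_le _ _).trans (natDegree_RR _ _ _)

lemma coeff_polyM (p q : ℝ) (n : ℕ) :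
    (polyM p q n).coeff n = (ascPochhammer ℝ n).eval (p - 2 * n) := by
  have h : ((-1:ℝ))^n = ∏ i ∈ Finset.range n, (-1:ℝ) := by simp
  rw [polyM, Polynomial.coeff_C_mul, coeff_RR, prod_eq_asc, h, ← Finset.prod_mul_distrib]
  refine Finset.prod_congr rfl fun i _ => ?_
  ring

lemma integral_polyM (p q : ℝ) (n : ℕ) (hq : -1 < q) (hp : 2 * (n:ℝ) + 1 < p) (A : Polynomial ℝ)
    (hA : A.natDegree ≤ n) :
    ∫ x in Set.Ioi (0:ℝ), A.eval x * (polyM p q n).eval x * (x ^ q * (1+x) ^ (-(p+q)))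
      = n.factorial * A.coeff n *
        (Real.Gamma (q + 1 + n) * Real.Gamma (p - 2*n - 1) / Real.Gamma (p + q - n)) := by
  have hA' : (A.natDegree : ℝ) ≤ n := by exact_mod_cast hA
  have h := parts_RR (n+q) (n-p-q) n A (by linarith) (by linarith)
  have hd : Polynomial.derivative^[n] A = Polynomial.C (n.factorial * A.coeff n) := by
    have h0 : (Polynomial.derivative^[n] A).natDegree ≤ 0 :=
      (Polynomial.natDegree_iterate_derivative A n).trans (by omega)
    rw [Polynomial.eq_C_of_natDegree_le_zero h0, Polynomial.coeff_iterate_derivative]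
    simp [Nat.descFactorial_self]
  rw [hd, show (n:ℝ) + q - n = q by ring, show (n:ℝ) - p - q - n = -(p+q) by ring] at h
  have e : ∀ x : ℝ, A.eval x * (polyM p q n).eval x * (x ^ q * (1+x) ^ (-(p+q)))
      = (-1)^n * (x ^ q * (1+x) ^ (-(p+q)) * (A * RR (n+q) (n-p-q) n).eval x) := by
    intro x
    simp only [polyM, Polynomial.eval_mul, Polynomial.eval_C]; ring
  have hn0 : (0:ℝ) ≤ n := Nat.cast_nonneg n
  have hb := (beta_Ioi (s := q + 1 + n) (t := p - 2*n-1) (by linarith) (by linarith)).2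
  rw [show q + 1 + (n:ℝ) - 1 = n + q by ring, show -(q + 1 + (n:ℝ) + (p - 2*n-1)) = n - p - q by ring,
    show q + 1 + (n:ℝ) + (p - 2*n-1) = p + q - n by ring] at hb
  simp only [e, integral_const_mul]
  rw [h]
  simp only [Polynomial.eval_C, integral_mul_const]
  rw [hb, ← mul_assoc, ← mul_pow]
  simp
  ring

lemma norm_polyM (p q : ℝ) (n : ℕ) (hq : -1 < q) (hp : 2 * (n:ℝ) + 1 < p) :
    ∫ x in Set.Ioi (0:ℝ), (polyM p q n).eval x * (polyM p q n).eval x * (x ^ q * (1+x) ^ (-(p+q)))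
      = hM p q n / cM p q := by
  have hn : (0:ℝ) ≤ n := Nat.cast_nonneg n
  rw [integral_polyM p q n hq hp _ (natDegree_polyM _ _ _), coeff_polyM, hM, cM,
    gamma_add_nat (s := q+1) (by linarith)]
  have h1 := gamma_add_nat (s := p - 2*n) (by linarith) n
  have h2 := Real.Gamma_add_one (s := p - 2*n - 1) (by linarith)
  rw [show p - 2*(n:ℝ) + n = p - n by ring] at h1
  rw [show p - 2*(n:ℝ) - 1 + 1 = p - 2*n by ring] at h2
  rw [h1, h2]
  have g1 := (Real.Gamma_pos_of_pos (s := p + q) (by linarith)).ne'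
  have g2 := (Real.Gamma_pos_of_pos (s := p + q - n) (by linarith)).ne'
  have g3 := (Real.Gamma_pos_of_pos (s := p - 1) (by linarith)).ne'
  have g4 := (Real.Gamma_pos_of_pos (s := q + 1) (by linarith)).ne'
  have g5 : p - 2*n - 1 ≠ 0 := by linarith
  field_simp

lemma orth_polyM (p q : ℝ) (n k : ℕ) (hk : k < n) (hq : -1 < q) (hp : 2 * (n:ℝ) + 1 < p) :
    ∫ x in Set.Ioi (0:ℝ), (polyM p q k).eval x * (polyM p q n).eval x * (x ^ q * (1+x) ^ (-(p+q))) = 0 := by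
  have := natDegree_polyM p q k
  rw [integral_polyM p q n hq hp _ (by omega), Polynomial.coeff_eq_zero_of_natDegree_lt (by omega)]
  simp

theorem stmt11 (d : ℕ) (hd : 2 ≤ d)
    (m n m' n' : ℕ) (hmn : m ≤ n) (hmn' : m' ≤ n') (p q : ℝ)
    (hp : 2 * ((max n n' : ℕ) : ℝ) + d < p) (hq : -(d : ℝ) < q)
    (Y Y' : MvPolynomial (Fin d) ℝ)
    (hY : IsSphericalHarmonic d m Y) (hY' : IsSphericalHarmonic d m' Y') :
    (cM (p - d + 1) (q + d - 1) / omegaSphere d) *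
      ∫ t in Set.Ioi (0 : ℝ),
        (∫ ξ : Metric.sphere (0 : EuclideanSpace ℝ (Fin d)) 1,
            finiteM (p - 2 * m - d + 1) (q + 2 * m + d - 1) (n - m) t *
              MvPolynomial.eval (fun i => t * (ξ : EuclideanSpace ℝ (Fin d)) i) Y *
            (finiteM (p - 2 * m' - d + 1) (q + 2 * m' + d - 1) (n' - m') t *
              MvPolynomial.eval (fun i => t * (ξ : EuclideanSpace ℝ (Fin d)) i) Y')
            ∂(sphereMeasure d)) *
        (t ^ (q + (d : ℝ) - 1) * (1 + t) ^ (-(p + q))) =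
    if n = n' ∧ m = m' then
      (cM (p - d + 1) (q + d - 1) / cM (p - 2 * m - d + 1) (q + 2 * m + d - 1)) *
        hM (p - 2 * m - d + 1) (q + 2 * m + d - 1) (n - m) *
        ((1 / omegaSphere d) *
          ∫ ξ : Metric.sphere (0 : EuclideanSpace ℝ (Fin d)) 1,
            MvPolynomial.eval (fun i => (ξ : EuclideanSpace ℝ (Fin d)) i) Y *
              MvPolynomial.eval (fun i => (ξ : EuclideanSpace ℝ (Fin d)) i) Y'
            ∂(sphereMeasure d))
    else 0 := by
  have hnn : (n:ℝ) ≤ ((max n n' : ℕ) : ℝ) := by exact_mod_cast le_max_left n n'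
  have hnn' : (n':ℝ) ≤ ((max n n' : ℕ) : ℝ) := by exact_mod_cast le_max_right n n'
  have hmr : (m:ℝ) ≤ n := by exact_mod_cast hmn
  have hmr0 : (0:ℝ) ≤ m := Nat.cast_nonneg m
  set S : ℝ := ∫ ξ : Metric.sphere (0 : EuclideanSpace ℝ (Fin d)) 1,
            MvPolynomial.eval (fun i => (ξ : EuclideanSpace ℝ (Fin d)) i) Y *
              MvPolynomial.eval (fun i => (ξ : EuclideanSpace ℝ (Fin d)) i) Y'
            ∂(sphereMeasure d) with hS
  have e : ∀ t : ℝ, (∫ ξ : Metric.sphere (0 : EuclideanSpace ℝ (Fin d)) 1,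
            finiteM (p - 2 * m - d + 1) (q + 2 * m + d - 1) (n - m) t *
              MvPolynomial.eval (fun i => t * (ξ : EuclideanSpace ℝ (Fin d)) i) Y *
            (finiteM (p - 2 * m' - d + 1) (q + 2 * m' + d - 1) (n' - m') t *
              MvPolynomial.eval (fun i => t * (ξ : EuclideanSpace ℝ (Fin d)) i) Y')
            ∂(sphereMeasure d)) =
      (finiteM (p - 2 * m - d + 1) (q + 2 * m + d - 1) (n - m) t *
        finiteM (p - 2 * m' - d + 1) (q + 2 * m' + d - 1) (n' - m') t * (t ^ m * t ^ m')) * S := by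
    intro t
    rw [hS, ← integral_const_mul]
    congr 1
    ext ξ
    rw [eval_homog hY.1, eval_homog hY'.1]
    ring
  simp only [e]
  by_cases hm : m = m'
  swap
  · have hS0 : S = 0 := orth_sphere hd Y Y' hY.1 hY.2 hY'.1 hY'.2 hm
    simp [hS0, hm]
  subst hm
  have e2 : ∀ t ∈ Set.Ioi (0:ℝ), (finiteM (p - 2 * m - d + 1) (q + 2 * m + d - 1) (n - m) t *
        finiteM (p - 2 * m - d + 1) (q + 2 * m + d - 1) (n' - m) t * (t ^ m * t ^ m)) * S *
        (t ^ (q + (d : ℝ) - 1) * (1 + t) ^ (-(p + q)))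
      = S * ((polyM (p - 2 * m - d + 1) (q + 2 * m + d - 1) (n - m)).eval t *
        (polyM (p - 2 * m - d + 1) (q + 2 * m + d - 1) (n' - m)).eval t *
        (t ^ (q + 2 * m + d - 1) * (1+t) ^ (-((p - 2 * m - d + 1) + (q + 2 * m + d - 1))))) := by
    intro t ht
    have ht : 0 < t := ht
    rw [finiteM_eq _ _ _ ht, finiteM_eq _ _ _ ht,
      show (p - 2 * m - d + 1) + (q + 2 * m + d - 1) = p + q by ring,
      show q + 2 * m + d - 1 = (m:ℝ) + m + (q + d - 1) by ring, rpow_add ht, rpow_add ht, rpow_natCast]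
    ring
  rw [setIntegral_congr_fun measurableSet_Ioi e2, integral_const_mul]
  have hQ : -1 < q + 2 * m + d - 1 := by linarith
  rcases lt_trichotomy n n' with h | h | h
  · rw [orth_polyM _ _ (n' - m) (n - m) (by omega) hQ (by push_cast [hmn']; linarith)]
    simp [h.ne]
  · subst h
    rw [norm_polyM _ _ _ hQ (by push_cast [hmn]; linarith)]
    simp
    ring
  · have : ∀ t : ℝ, (polyM (p - 2 * m - d + 1) (q + 2 * m + d - 1) (n - m)).eval t *
        (polyM (p - 2 * m - d + 1) (q + 2 * m + d - 1) (n' - m)).eval t =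
        (polyM (p - 2 * m - d + 1) (q + 2 * m + d - 1) (n' - m)).eval t *
        (polyM (p - 2 * m - d + 1) (q + 2 * m + d - 1) (n - m)).eval t := fun t => mul_comm _ _
    simp only [this]
    rw [orth_polyM _ _ (n - m) (n' - m) (by omega) hQ (by push_cast [hmn]; linarith)]
    simp [h.ne']
end

section
/- Let d ≥ 2 be an integer, m ≤ n natural numbers, and p a real number. Define g(t) = M_{n−m}^{(p−2m−d+1, 2m+d−2)}(t) · t^m for t > 0. Then for every t > 0: t(1+t) g″(t) + ( d−1 + (−p+d+1)t ) g′(t) − m(m+d−2) t^{−1} g(t) = n(n−p+d) g(t). (Equivalently, since a degree-m spherical harmonic Y satisfies Δ₀Y = −m(m+d−2)Y for the Laplace–Beltrami operator Δ₀ on S^{d−1}, the surface-of-cone polynomial S(x,t) = M_{n−m}^{(p−2m−d+1, 2m+d−2)}(t) Y(x), written as g(t)Y(ξ) with x = tξ, satisfies [t(1+t)∂_t² + (d−1+(−p+d+1)t)∂_t + t^{−1}Δ₀^{(x)}] S = n(n−p+d) S, which is the weight w_{p,−1} case.) -/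
open Real

theorem aux_contDiffAt (a b : ℝ) (k : ℕ) (t : ℝ) (ht : 0 < t) :
    ContDiffAt ℝ k (fun y : ℝ => y ^ a * (1 + y) ^ b) t := by
  apply ContDiffAt.mul
  · exact contDiffAt_id.rpow_const_of_ne ht.ne'
  · exact (contDiffAt_const.add contDiffAt_id).rpow_const_of_ne (by simp; linarith)

theorem aux_hasDeriv (a b : ℝ) (k : ℕ) (t : ℝ) (ht : 0 < t) :
    HasDerivAt (iteratedDeriv k (fun y : ℝ => y ^ a * (1 + y) ^ b))
      (iteratedDeriv (k + 1) (fun y : ℝ => y ^ a * (1 + y) ^ b) t) t := by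
  rw [iteratedDeriv_succ]
  apply DifferentiableAt.hasDerivAt
  have h := (aux_contDiffAt a b (k + 1) t ht)
  rw [← contDiffWithinAt_univ] at h
  have h2 := h.differentiableWithinAt_iteratedDerivWithin (m := k)
    (by exact_mod_cast Nat.lt_succ_self k) (by simp)
  rwa [iteratedDerivWithin_univ, differentiableWithinAt_univ] at h2

theorem aux_rpow (a t : ℝ) (ht : 0 < t) :
    HasDerivAt (fun y : ℝ => y ^ a) (t ^ a * (a / t)) t := by
  convert Real.hasDerivAt_rpow_const (x := t) (p := a) (Or.inl ht.ne') using 1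
  rw [Real.rpow_sub_one ht.ne']
  ring

theorem aux_rpow1 (a t : ℝ) (ht : 0 < t) :
    HasDerivAt (fun y : ℝ => (1 + y) ^ a) ((1 + t) ^ a * (a / (1 + t))) t := by
  have h := (aux_rpow a (1 + t) (by linarith)).comp t ((hasDerivAt_id t).const_add 1)
  simpa [Function.comp_def] using h

theorem aux_base (a b t : ℝ) (ht : 0 < t) :
    t * (1 + t) * iteratedDeriv 1 (fun y : ℝ => y ^ a * (1 + y) ^ b) t
      = (a + (a + b) * t) * iteratedDeriv 0 (fun y : ℝ => y ^ a * (1 + y) ^ b) t := by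
  have h := ((aux_rpow a t ht).mul (aux_rpow1 b t ht)).deriv
  have h' : deriv (fun y : ℝ => y ^ a * (1 + y) ^ b) t = _ := h
  rw [iteratedDeriv_one, iteratedDeriv_zero, h']
  have : 1 + t ≠ 0 := by linarith
  field_simp
  ring

theorem aux_unique {f g : ℝ → ℝ} {t f' g' : ℝ} (ht : 0 < t) (hf : HasDerivAt f f' t)
    (hg : HasDerivAt g g' t) (h : ∀ y, 0 < y → f y = g y) : f' = g' := by
  have hE : f =ᶠ[nhds t] g := by
    filter_upwards [lt_mem_nhds ht] with y hy
    exact h y hy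
  exact (hf.congr_of_eventuallyEq hE.symm).unique hg

theorem aux_rec (a b : ℝ) (k : ℕ) : ∀ t : ℝ, 0 < t →
    t * (1 + t) * iteratedDeriv (k + 2) (fun y : ℝ => y ^ a * (1 + y) ^ b) t
      + ((k : ℝ) + 1) * (1 + 2 * t) * iteratedDeriv (k + 1) (fun y : ℝ => y ^ a * (1 + y) ^ b) t
      + ((k : ℝ) + 1) * k * iteratedDeriv k (fun y : ℝ => y ^ a * (1 + y) ^ b) t
      = (a + (a + b) * t) * iteratedDeriv (k + 1) (fun y : ℝ => y ^ a * (1 + y) ^ b) t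
      + ((k : ℝ) + 1) * (a + b) * iteratedDeriv k (fun y : ℝ => y ^ a * (1 + y) ^ b) t := by
  induction k with
  | zero =>
    intro t ht
    have h0 := aux_hasDeriv a b 0 t ht
    have h1 := aux_hasDeriv a b 1 t ht
    have hi := hasDerivAt_id t
    have hL := (hi.mul (hi.const_add 1)).mul h1
    have hR := ((hi.const_mul (a + b)).const_add a).mul h0
    have := aux_unique ht hL hR (fun y hy => aux_base a b y hy)
    simp only [id, Pi.mul_apply] at this
    push_cast
    simp only [Nat.reduceAdd, zero_add] at this ⊢
    linear_combination this
  | succ k ih =>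
    intro t ht
    have h0 := aux_hasDeriv a b k t ht
    have h1 := aux_hasDeriv a b (k + 1) t ht
    have h2 := aux_hasDeriv a b (k + 2) t ht
    have hi := hasDerivAt_id t
    have hL := (((hi.mul (hi.const_add 1)).mul h2).add
      ((((hi.const_mul 2).const_add 1).const_mul ((k : ℝ) + 1)).mul h1)).add
      (h0.const_mul (((k : ℝ) + 1) * k))
    have hR := (((hi.const_mul (a + b)).const_add a).mul h1).add
      (h0.const_mul (((k : ℝ) + 1) * (a + b)))
    have := aux_unique ht hL hR (fun y hy => ih y hy)
    simp only [id, Pi.mul_apply] at this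
    push_cast
    simp only [add_assoc, Nat.reduceAdd] at this ⊢
    linear_combination this

theorem stmt12 (d : ℕ) (hd : 2 ≤ d) (m n : ℕ) (hmn : m ≤ n) (p : ℝ)
    (g : ℝ → ℝ)
    (hg : ∀ t : ℝ, g t =
      finiteM (p - 2 * m - d + 1) (2 * (m : ℝ) + d - 2) (n - m) t * t ^ m) :
    ∀ t : ℝ, 0 < t →
      t * (1 + t) * deriv (deriv g) t + ((d : ℝ) - 1 + (-p + d + 1) * t) * deriv g t
        - (m : ℝ) * ((m : ℝ) + d - 2) * t⁻¹ * g t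
      = (n : ℝ) * ((n : ℝ) - p + d) * g t := by
  obtain ⟨N, rfl⟩ := Nat.exists_eq_add_of_le hmn
  intro t ht
  rw [Nat.add_sub_cancel_left] at hg
  unfold finiteM at hg
  obtain ⟨q, hq⟩ : ∃ q : ℝ, q = 2 * (m : ℝ) + d - 2 := ⟨_, rfl⟩
  obtain ⟨P, hP⟩ : ∃ P : ℝ, P = p - 2 * m - d + 1 := ⟨_, rfl⟩
  rw [← hq, ← hP] at hg
  have hrec := aux_rec ((N : ℝ) + q) ((N : ℝ) - P - q) N t ht
  have hD := aux_hasDeriv ((N : ℝ) + q) ((N : ℝ) - P - q)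
  generalize hF : (fun y : ℝ => y ^ ((N : ℝ) + q) * (1 + y) ^ ((N : ℝ) - P - q)) = F at *
  obtain ⟨φ, hφ⟩ : ∃ φ : ℝ → ℝ,
      φ = fun y => (-1 : ℝ) ^ N * ((1 + y) ^ (P + q) * y ^ (-q) * y ^ (m : ℝ)) := ⟨_, rfl⟩
  have hφ' : ∀ y, 0 < y → HasDerivAt φ (φ y * ((P + q) / (1 + y) + (m - q) / y)) y := by
    intro y hy
    have := (((aux_rpow1 (P + q) y hy).mul (aux_rpow (-q) y hy)).mul
      (aux_rpow m y hy)).const_mul ((-1 : ℝ) ^ N)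
    rw [hφ]
    refine this.congr_deriv ?_
    simp only [Pi.mul_apply, hφ]
    ring
  have hg1 : g = fun y => φ y * iteratedDeriv N F y := by
    funext y
    rw [hg, hφ]
    simp only [Real.rpow_natCast]
    ring
  have hgd : ∀ y, 0 < y → HasDerivAt g (φ y * (((P + q) / (1 + y) + (m - q) / y)
      * iteratedDeriv N F y + iteratedDeriv (N + 1) F y)) y := by
    intro y hy
    have := (hφ' y hy).mul (hD N y hy)
    rw [hg1]
    refine this.congr_deriv ?_
    ring
  have ht1 : 1 + t ≠ 0 := by linarith
  have hr : HasDerivAt (fun y : ℝ => (P + q) / (1 + y) + (m - q) / y)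
      (-(P + q) / (1 + t) ^ 2 + -(m - q) / t ^ 2) t := by
    have hi := hasDerivAt_id t
    have := ((hasDerivAt_const t (P + q)).div (hi.const_add 1) ht1).add
      ((hasDerivAt_const t ((m : ℝ) - q)).div hi ht.ne')
    refine this.congr_deriv ?_
    simp [id]
  have hg2 := ((hφ' t ht).mul ((hr.mul (hD N t ht)).add (hD (N + 1) t ht)))
  have hE : deriv g =ᶠ[nhds t] (φ * ((fun y => (P + q) / (1 + y) + (m - q) / y)
      * iteratedDeriv N F + iteratedDeriv (N + 1) F)) := by
    filter_upwards [lt_mem_nhds ht] with y hy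
    exact (hgd y hy).deriv
  have hg3 : deriv (deriv g) t = _ := hE.deriv_eq.trans hg2.deriv
  rw [hg3, (hgd t ht).deriv, hg1]
  simp only [Pi.mul_apply, Pi.add_apply, add_assoc, Nat.reduceAdd] at hrec ⊢
  generalize iteratedDeriv N F t = D0 at *
  generalize iteratedDeriv (N + 1) F t = D1 at *
  have hD2 : iteratedDeriv (N + 2) F t = ((N + q + (N + q + (N - P - q)) * t) * D1
      + (N + 1) * (N + q + (N - P - q)) * D0 - (N + 1) * (1 + 2 * t) * D1
      - (N + 1) * N * D0) / (t * (1 + t)) := by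
    field_simp
    linear_combination hrec
  rw [hD2]
  generalize φ t = f at *
  have hp : p = P + 2 * m + d - 1 := by linarith
  have hdd : (d : ℝ) = q - 2 * m + 2 := by linarith
  rw [hp, hdd]
  push_cast
  field_simp
  ring
end
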